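/- Let p, r : [0,1] → ℝ be continuous with p(x) > 0 and r(x) > 0 for all x ∈ [0,1], and let n ≥ 1. Suppose λ ∈ ℝ is an eigenvalue of the problem (p·y'')'' = λ·r·y with boundary conditions y(0) = y'(0) = y(1) = y'(1) = 0, suppose the set of eigenvalues μ of this problem with μ < λ has exactly n − 1 elements, and let y be a nontrivial classical solution at λ. Then the set {x ∈ (0,1) : y(x) = 0} has exactly n − 1 elements, and y'(a) ≠ 0 for every a ∈ (0,1) with y(a) = 0. -/

import Mathlib

open Set

/-- Derivative within the interval `[0,1]`. -/
noncomputable def Dv (y : ℝ → ℝ) : ℝ → ℝ := derivWithin y (Set.Icc 0 1)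

/-- `y` is not identically zero on `[0,1]`. -/
def Nontriv (y : ℝ → ℝ) : Prop := ∃ x ∈ Set.Icc (0:ℝ) 1, y x ≠ 0

/-- `y` is a classical solution of `(p y'')'' = lam * r * y` on `[0,1]`. -/
def SolS (p r : ℝ → ℝ) (lam : ℝ) (y : ℝ → ℝ) : Prop :=
  ContDiffOn ℝ 2 y (Set.Icc 0 1) ∧
  ContDiffOn ℝ 2 (fun x => p x * Dv (Dv y) x) (Set.Icc 0 1) ∧
  ∀ x ∈ Set.Icc (0:ℝ) 1,
    Dv (Dv (fun t => p t * Dv (Dv y) t)) x = lam * (r x * y x)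

/-- Clamped boundary conditions `y(0) = y'(0) = y(1) = y'(1) = 0`. -/
def BC1 (y : ℝ → ℝ) : Prop := y 0 = 0 ∧ Dv y 0 = 0 ∧ y 1 = 0 ∧ Dv y 1 = 0

/-- Boundary conditions `y(0) = y'(0) = y'(1) = 0`, `(p y'')'(1) + lam * alpha * y(1) = 0`. -/
def BC2S (p : ℝ → ℝ) (lam alpha : ℝ) (y : ℝ → ℝ) : Prop :=
  y 0 = 0 ∧ Dv y 0 = 0 ∧ Dv y 1 = 0 ∧
  Dv (fun t => p t * Dv (Dv y) t) 1 + lam * alpha * y 1 = 0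

/-- Linear dependence of two functions on `[0,1]`. -/
def LinDep (y₁ y₂ : ℝ → ℝ) : Prop :=
  ∃ a b : ℝ, (a ≠ 0 ∨ b ≠ 0) ∧ ∀ x ∈ Set.Icc (0:ℝ) 1, a * y₁ x + b * y₂ x = 0

/-- `lam` is an eigenvalue of `(p y'')'' = lam r y` with boundary conditions (BC1). -/
def EigS1 (p r : ℝ → ℝ) (lam : ℝ) : Prop :=
  ∃ y : ℝ → ℝ, SolS p r lam y ∧ Nontriv y ∧ BC1 y


section Helpers

open Filter Topology MeasureTheory

/-! ### Basic calculus on `[0,1]` -/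

/-- `f` has derivative `g` on `[0,1]`. -/
def HD (f g : ℝ → ℝ) : Prop := ∀ x ∈ Icc (0:ℝ) 1, HasDerivWithinAt f (g x) (Icc 0 1) x

theorem HD.cont {f g : ℝ → ℝ} (h : HD f g) : ContinuousOn f (Icc 0 1) :=
  fun x hx => (h x hx).continuousWithinAt

theorem HD.at {f g : ℝ → ℝ} (h : HD f g) {x : ℝ} (hx : x ∈ Ioo (0:ℝ) 1) : HasDerivAt f (g x) x :=
  (h x (Ioo_subset_Icc_self hx)).hasDerivAt (Icc_mem_nhds hx.1 hx.2)

theorem HD.rolle {f g : ℝ → ℝ} (h : HD f g) {a b : ℝ} (ha : a ∈ Icc (0:ℝ) 1)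
    (hb : b ∈ Icc (0:ℝ) 1) (hab : a < b) (hf : f a = f b) : ∃ c ∈ Ioo a b, g c = 0 :=
  exists_hasDerivAt_eq_zero hab (h.cont.mono (Icc_subset_Icc ha.1 hb.2)) hf
    fun x hx => h.at ⟨ha.1.trans_lt hx.1, hx.2.trans_le hb.2⟩

theorem HD.strictMono {f g : ℝ → ℝ} (h : HD f g) {a b : ℝ} (ha : 0 ≤ a)
    (hb : b ≤ 1) (hp : ∀ x ∈ Ioo a b, 0 < g x) : StrictMonoOn f (Icc a b) := by
  apply strictMonoOn_of_deriv_pos (convex_Icc a b) (h.cont.mono (Icc_subset_Icc ha hb))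
  intro x hx
  rw [interior_Icc] at hx
  rw [(h.at ⟨ha.trans_lt hx.1, hx.2.trans_le hb⟩).deriv]
  exact hp x hx

theorem HD.mono {f g : ℝ → ℝ} (h : HD f g) {a b : ℝ} (ha : 0 ≤ a)
    (hb : b ≤ 1) (hp : ∀ x ∈ Ioo a b, 0 ≤ g x) : MonotoneOn f (Icc a b) := by
  apply monotoneOn_of_deriv_nonneg (convex_Icc a b) (h.cont.mono (Icc_subset_Icc ha hb))
  · intro x hx
    rw [interior_Icc] at hx
    exact (h.at ⟨ha.trans_lt hx.1, hx.2.trans_le hb⟩).differentiableAt.differentiableWithinAt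
  · intro x hx
    rw [interior_Icc] at hx
    rw [(h.at ⟨ha.trans_lt hx.1, hx.2.trans_le hb⟩).deriv]
    exact hp x hx

theorem HD.add {f g f' g' : ℝ → ℝ} (h : HD f g) (h' : HD f' g') :
    HD (fun x => f x + f' x) (fun x => g x + g' x) := fun x hx => (h x hx).add (h' x hx)

theorem HD.smul {f g : ℝ → ℝ} (c : ℝ) (h : HD f g) :
    HD (fun x => c * f x) (fun x => c * g x) := fun x hx => (h x hx).const_mul c

theorem HD.mul {f g f' g' : ℝ → ℝ} (h : HD f g) (h' : HD f' g') :
    HD (fun x => f x * f' x) (fun x => g x * f' x + f x * g' x) :=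
  fun x hx => (h x hx).mul (h' x hx)

theorem HD.congr {f g g' : ℝ → ℝ} (h : HD f g) (e : ∀ x ∈ Icc (0:ℝ) 1, g x = g' x) : HD f g' :=
  fun x hx => e x hx ▸ h x hx

theorem HD.refl {f g : ℝ → ℝ} (h : HD f g) :
    HD (fun x => f (1 - x)) (fun x => - g (1 - x)) := by
  intro x hx
  have h1 : HasDerivWithinAt (fun x : ℝ => 1 - x) (-1) (Icc 0 1) x := by
    simpa using (hasDerivWithinAt_id x (Icc 0 1)).const_sub (1:ℝ)
  have hm : MapsTo (fun x : ℝ => 1 - x) (Icc 0 1) (Icc 0 1) := by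
    intro t ht; constructor <;> linarith [ht.1, ht.2]
  have := (h (1 - x) (hm hx)).comp x h1 hm
  simpa [Function.comp_def] using this

theorem HD.ftc {f g : ℝ → ℝ} (h : HD f g) (hg : ContinuousOn g (Icc 0 1)) :
    ∫ x in (0:ℝ)..1, g x = f 1 - f 0 :=
  intervalIntegral.integral_eq_sub_of_hasDerivAt_of_le zero_le_one h.cont (fun _ hx => h.at hx)
    (hg.intervalIntegrable_of_Icc zero_le_one)

/-- Existence of primitives. -/
theorem exists_prim {g : ℝ → ℝ} (hg : ContinuousOn g (Icc 0 1)) : ∃ f, HD f g ∧ f 0 = 0 := by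
  let G : ℝ → ℝ := IccExtend (zero_le_one (α := ℝ)) ((Icc (0:ℝ) 1).domRestrict g)
  have hG : Continuous G := (continuousOn_iff_continuous_domRestrict.1 hg).Icc_extend'
  have hGe : ∀ x ∈ Icc (0:ℝ) 1, G x = g x := by
    intro x hx
    simp only [G]
    rw [IccExtend_of_mem _ _ hx]; rfl
  refine ⟨fun x => ∫ t in (0:ℝ)..x, G t, ?_, by simp⟩
  intro x hx
  rw [← hGe x hx]
  exact (hG.integral_hasStrictDerivAt 0 x).hasDerivAt.hasDerivWithinAt

/-! ### The system -/

/-- First order system form of `(p y'')'' = r f`. -/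
structure Sy (p r f y v w z : ℝ → ℝ) : Prop where
  dy : HD y v
  dv : HD v (fun x => w x / p x)
  dw : HD w z
  dz : HD z (fun x => r x * f x)

/-- Clamped solution of `(p y'')'' = r f`. -/
structure Cl (p r f y v w z : ℝ → ℝ) : Prop extends Sy p r f y v w z where
  y0 : y 0 = 0
  v0 : v 0 = 0
  y1 : y 1 = 0
  v1 : v 1 = 0

/-- Admissible coefficients. -/
structure Coef (p r : ℝ → ℝ) : Prop where
  pc : ContinuousOn p (Icc 0 1)
  rc : ContinuousOn r (Icc 0 1)
  pp : ∀ x ∈ Icc (0:ℝ) 1, 0 < p x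
  rp : ∀ x ∈ Icc (0:ℝ) 1, 0 < r x

theorem Sy.add {p r f y v w z f' y' v' w' z' : ℝ → ℝ} (h : Sy p r f y v w z)
    (h' : Sy p r f' y' v' w' z') :
    Sy p r (fun x => f x + f' x) (fun x => y x + y' x) (fun x => v x + v' x)
      (fun x => w x + w' x) (fun x => z x + z' x) :=
  ⟨h.dy.add h'.dy, (h.dv.add h'.dv).congr fun x _ => by ring, h.dw.add h'.dw,
    (h.dz.add h'.dz).congr fun x _ => by ring⟩

theorem Sy.smul {p r f y v w z : ℝ → ℝ} (c : ℝ) (h : Sy p r f y v w z) :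
    Sy p r (fun x => c * f x) (fun x => c * y x) (fun x => c * v x)
      (fun x => c * w x) (fun x => c * z x) :=
  ⟨h.dy.smul c, (h.dv.smul c).congr fun x _ => by ring, h.dw.smul c,
    (h.dz.smul c).congr fun x _ => by ring⟩

theorem Sy.congr {p r f f' y v w z : ℝ → ℝ} (h : Sy p r f y v w z)
    (e : ∀ x ∈ Icc (0:ℝ) 1, f x = f' x) : Sy p r f' y v w z :=
  ⟨h.dy, h.dv, h.dw, h.dz.congr fun x hx => by rw [e x hx]⟩

theorem Cl.add {p r f y v w z f' y' v' w' z' : ℝ → ℝ} (h : Cl p r f y v w z)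
    (h' : Cl p r f' y' v' w' z') :
    Cl p r (fun x => f x + f' x) (fun x => y x + y' x) (fun x => v x + v' x)
      (fun x => w x + w' x) (fun x => z x + z' x) :=
  ⟨h.toSy.add h'.toSy, by simp [h.y0, h'.y0], by simp [h.v0, h'.v0], by simp [h.y1, h'.y1],
    by simp [h.v1, h'.v1]⟩

theorem Cl.smul {p r f y v w z : ℝ → ℝ} (c : ℝ) (h : Cl p r f y v w z) :
    Cl p r (fun x => c * f x) (fun x => c * y x) (fun x => c * v x)
      (fun x => c * w x) (fun x => c * z x) :=
  ⟨h.toSy.smul c, by simp [h.y0], by simp [h.v0], by simp [h.y1], by simp [h.v1]⟩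

theorem Cl.congr {p r f f' y v w z : ℝ → ℝ} (h : Cl p r f y v w z)
    (e : ∀ x ∈ Icc (0:ℝ) 1, f x = f' x) : Cl p r f' y v w z :=
  ⟨h.toSy.congr e, h.y0, h.v0, h.y1, h.v1⟩

theorem Sy.refl {p r f y v w z : ℝ → ℝ} (h : Sy p r f y v w z) :
    Sy (fun x => p (1 - x)) (fun x => r (1 - x)) (fun x => f (1 - x)) (fun x => y (1 - x))
      (fun x => - v (1 - x)) (fun x => w (1 - x)) (fun x => - z (1 - x)) :=
  ⟨h.dy.refl, fun x hx => by
      have := (h.dv.refl.smul (-1)) x hx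
      simpa using this, h.dw.refl, fun x hx => by
      have := (h.dz.refl.smul (-1)) x hx
      simpa using this⟩

theorem refl_mem {x : ℝ} (hx : x ∈ Icc (0:ℝ) 1) : 1 - x ∈ Icc (0:ℝ) 1 :=
  ⟨by linarith [hx.2], by linarith [hx.1]⟩

theorem Coef.refl {p r : ℝ → ℝ} (h : Coef p r) : Coef (fun x => p (1 - x)) (fun x => r (1 - x)) :=
  ⟨h.pc.comp (by fun_prop) fun _ hx => refl_mem hx, h.rc.comp (by fun_prop) fun _ hx => refl_mem hx,
    fun _ hx => h.pp _ (refl_mem hx), fun _ hx => h.rp _ (refl_mem hx)⟩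

/-! ### Leighton-Nehari type lemmas -/

theorem LN_strict {p r y v w z : ℝ → ℝ} {l : ℝ} (hc : Coef p r) (hl : 0 < l)
    (h : Sy p r (fun x => l * y x) y v w z) {b : ℝ} (hb : b ∈ Icc (0:ℝ) 1)
    (hy : 0 < y b) (hv : 0 < v b) (hw : 0 < w b) (hz : 0 < z b) : 0 < y 1 := by
  by_contra hneg
  let m : ℝ → ℝ := fun x => min (min (y x) (v x)) (min (w x) (z x))
  have hm : ContinuousOn m (Icc b 1) :=
    ((h.dy.cont.inf h.dv.cont).inf (h.dw.cont.inf h.dz.cont)).mono (Icc_subset_Icc_left hb.1)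
  have hB : IsCompact {x ∈ Icc b 1 | m x ≤ 0} := by
    have : IsClosed {x ∈ Icc b 1 | m x ≤ 0} := by
      have := hm.preimage_isClosed_of_isClosed isClosed_Icc (isClosed_Iic (a := (0:ℝ)))
      exact this
    exact isCompact_Icc.of_isClosed_subset this fun x hx => hx.1
  obtain ⟨x0, ⟨hx0, hx0m⟩, hmin⟩ := hB.exists_isLeast ⟨1, ⟨⟨hb.2, le_rfl⟩, by
    simp only [m]; exact (min_le_left _ _).trans ((min_le_left _ _).trans (not_lt.1 hneg))⟩⟩
  have hpos : ∀ x ∈ Icc b 1, x < x0 → 0 < y x ∧ 0 < v x ∧ 0 < w x ∧ 0 < z x := by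
    intro x hx hxx
    have : 0 < m x := by
      by_contra hcon
      exact absurd (hmin ⟨hx, not_lt.1 hcon⟩) (not_le.2 hxx)
    simp only [m, lt_min_iff] at this
    exact ⟨this.1.1, this.1.2, this.2.1, this.2.2⟩
  have hbx : b < x0 := by
    rcases hx0.1.lt_or_eq with h1 | h1
    · exact h1
    · exfalso
      rw [← h1] at hx0m
      exact absurd hx0m (not_le.2 (by simp only [m, lt_min_iff]; exact ⟨⟨hy, hv⟩, hw, hz⟩))
  have key : ∀ x ∈ Ioo b x0, x ∈ Icc (0:ℝ) 1 ∧ 0 < y x ∧ 0 < v x ∧ 0 < w x ∧ 0 < z x :=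
    fun x hx => ⟨⟨hb.1.trans hx.1.le, hx.2.le.trans hx0.2⟩,
      hpos x ⟨hx.1.le, hx.2.le.trans hx0.2⟩ hx.2⟩
  have e1 := h.dy.mono hb.1 hx0.2 (fun x hx => (key x hx).2.2.1.le)
    (left_mem_Icc.2 hbx.le) (right_mem_Icc.2 hbx.le) hbx.le
  have e2 := h.dv.mono hb.1 hx0.2 (fun x hx =>
      (div_pos (key x hx).2.2.2.1 (hc.pp x (key x hx).1)).le)
    (left_mem_Icc.2 hbx.le) (right_mem_Icc.2 hbx.le) hbx.le
  have e3 := h.dw.mono hb.1 hx0.2 (fun x hx => (key x hx).2.2.2.2.le)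
    (left_mem_Icc.2 hbx.le) (right_mem_Icc.2 hbx.le) hbx.le
  have e4 := h.dz.mono hb.1 hx0.2 (fun x hx =>
      (mul_pos (hc.rp x (key x hx).1) (mul_pos hl (key x hx).2.1)).le)
    (left_mem_Icc.2 hbx.le) (right_mem_Icc.2 hbx.le) hbx.le
  refine absurd hx0m (not_le.2 ?_)
  simp only [m, lt_min_iff]
  exact ⟨⟨by linarith, by linarith⟩, by linarith, by linarith⟩

theorem pos_right {f : ℝ → ℝ} (hf : ContinuousOn f (Icc 0 1)) {a : ℝ} (ha : 0 ≤ a) (ha1 : a < 1)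
    (hp : 0 < f a) : ∃ b, a < b ∧ b ≤ 1 ∧ ∀ x ∈ Icc a b, 0 < f x := by
  have h1 : ∀ᶠ x in 𝓝[Icc 0 1] a, 0 < f x := (hf a ⟨ha, ha1.le⟩).eventually (lt_mem_nhds hp)
  rw [eventually_nhdsWithin_iff, Metric.eventually_nhds_iff] at h1
  obtain ⟨e, he, h1⟩ := h1
  refine ⟨min (a + e / 2) 1, lt_min (by linarith) ha1, min_le_right _ _, fun x hx => ?_⟩
  have h2 : x ≤ a + e / 2 := hx.2.trans (min_le_left _ _)
  have h3 : x ≤ 1 := hx.2.trans (min_le_right _ _)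
  refine h1 ?_ ⟨ha.trans hx.1, h3⟩
  rw [Real.dist_eq, abs_lt]; constructor <;> linarith [hx.1]

theorem LN_right {p r y v w z : ℝ → ℝ} {l : ℝ} (hc : Coef p r) (hl : 0 < l)
    (h : Sy p r (fun x => l * y x) y v w z) {a : ℝ} (ha : 0 ≤ a) (ha1 : a < 1)
    (hy : y a = 0) (hv : v a = 0) (hw : 0 ≤ w a) (hz : 0 ≤ z a) (hne : w a ≠ 0 ∨ z a ≠ 0) :
    0 < y 1 := by
  -- it suffices to have `w > 0` on a right neighbourhood
  obtain ⟨b, hab, hb1, hwp⟩ : ∃ b, a < b ∧ b ≤ 1 ∧ ∀ x ∈ Ioc a b, 0 < w x := by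
    rcases hw.lt_or_eq with hw | hw
    · obtain ⟨b, h1, h2, h3⟩ := pos_right h.dw.cont ha ha1 hw
      exact ⟨b, h1, h2, fun x hx => h3 x ⟨hx.1.le, hx.2⟩⟩
    · have hz' : 0 < z a := lt_of_le_of_ne hz (by
        rcases hne with h1 | h1
        · exact absurd hw.symm h1
        · exact h1.symm)
      obtain ⟨b, h1, h2, h3⟩ := pos_right h.dz.cont ha ha1 hz'
      refine ⟨b, h1, h2, fun x hx => ?_⟩
      have := h.dw.strictMono ha h2 (fun t ht => h3 t ⟨ht.1.le, ht.2.le⟩)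
        (left_mem_Icc.2 h1.le) ⟨hx.1.le, hx.2⟩ hx.1
      linarith
  have I : ∀ x ∈ Ioc a b, x ∈ Icc (0:ℝ) 1 := fun x hx => ⟨ha.trans hx.1.le, hx.2.trans hb1⟩
  have vp : ∀ x ∈ Ioc a b, 0 < v x := by
    intro x hx
    have := h.dv.strictMono ha hb1 (fun t ht =>
        div_pos (hwp t ⟨ht.1, ht.2.le⟩) (hc.pp t (I t ⟨ht.1, ht.2.le⟩)))
        (left_mem_Icc.2 hab.le) ⟨hx.1.le, hx.2⟩ hx.1
    linarith
  have yp : ∀ x ∈ Ioc a b, 0 < y x := by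
    intro x hx
    have := h.dy.strictMono ha hb1 (fun t ht => vp t ⟨ht.1, ht.2.le⟩)
        (left_mem_Icc.2 hab.le) ⟨hx.1.le, hx.2⟩ hx.1
    linarith
  have zp : 0 < z b := by
    have := h.dz.strictMono ha hb1 (fun t ht =>
        mul_pos (hc.rp t (I t ⟨ht.1, ht.2.le⟩)) (mul_pos hl (yp t ⟨ht.1, ht.2.le⟩)))
        (left_mem_Icc.2 hab.le) (right_mem_Icc.2 hab.le) hab
    linarith
  have hb : b ∈ Ioc a b := ⟨hab, le_rfl⟩
  exact LN_strict hc hl h (I b hb) (yp b hb) (vp b hb) (hwp b hb) zp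

theorem LN_left {p r y v w z : ℝ → ℝ} {l : ℝ} (hc : Coef p r) (hl : 0 < l)
    (h : Sy p r (fun x => l * y x) y v w z) {a : ℝ} (ha : 0 < a) (ha1 : a ≤ 1)
    (hy : y a = 0) (hv : v a = 0) (hw : 0 ≤ w a) (hz : z a ≤ 0) (hne : w a ≠ 0 ∨ z a ≠ 0) :
    0 < y 0 := by
  have := LN_right hc.refl hl h.refl (a := 1 - a) (by linarith) (by linarith)
    (by simpa using hy) (by simpa using hv) (by simpa using hw) (by simpa using hz)
    (by simpa using hne)
  simpa using this

theorem uniq_right {p r y v w z : ℝ → ℝ} {l : ℝ} (hc : Coef p r)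
    (h : Sy p r (fun x => l * y x) y v w z) {a : ℝ} (ha : a ∈ Icc (0:ℝ) 1)
    (hy : y a = 0) (hv : v a = 0) (hw : w a = 0) (hz : z a = 0) : ∀ x ∈ Icc a 1, y x = 0 := by
  have hpi : ContinuousOn (fun x => 1 / p x) (Icc 0 1) :=
    continuousOn_const.div hc.pc fun x hx => (hc.pp x hx).ne'
  have hlr : ContinuousOn (fun x => l * r x) (Icc 0 1) := continuousOn_const.mul hc.rc
  obtain ⟨M1, hM1⟩ := isCompact_Icc.exists_bound_of_continuousOn hpi
  obtain ⟨M2, hM2⟩ := isCompact_Icc.exists_bound_of_continuousOn hlr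
  simp only [Real.norm_eq_abs] at hM1 hM2
  set K := 2 + M1 + M2 with hK
  let N : ℝ → ℝ := fun x => y x * y x + v x * v x + (w x * w x + z x * z x)
  have hE : HD (fun x => Real.exp (-K * x)) (fun x => Real.exp (-K * x) * (-K)) := by
    intro x _
    have := ((hasDerivAt_id x).const_mul (-K)).exp.hasDerivWithinAt (s := Icc (0:ℝ) 1)
    simpa using this
  have hN := (((h.dy.mul h.dy).add (h.dv.mul h.dv)).add ((h.dw.mul h.dw).add (h.dz.mul h.dz)))
  have hG := (hE.mul hN).smul (-1)
  have hmono := hG.mono ha.1 le_rfl (by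
    intro x hx
    have hx' : x ∈ Icc (0:ℝ) 1 := ⟨ha.1.trans hx.1.le, hx.2.le⟩
    have b1 := abs_le.1 (hM1 x hx')
    have b2 := abs_le.1 (hM2 x hx')
    have he := Real.exp_pos (-K * x)
    set q := 1 / p x with hq
    have e1 : w x / p x = q * w x := by rw [hq]; ring
    rw [e1]
    set q2 := l * r x with hq2
    have e2 : r x * (l * y x) = q2 * y x := by rw [hq2]; ring
    rw [e2]
    have : 0 ≤ Real.exp (-K * x) * (K * (y x * y x + v x * v x + (w x * w x + z x * z x))
        - (v x * y x + y x * v x + (q * w x * v x + v x * (q * w x)) +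
          (z x * w x + w x * z x + (q2 * y x * z x + z x * (q2 * y x))))) := by
      apply mul_nonneg he.le
      have t1 : 2 * q * (w x * v x) ≤ M1 * (w x ^ 2 + v x ^ 2) := by
        nlinarith [mul_nonneg (by linarith : (0:ℝ) ≤ M1 - q) (sq_nonneg (w x + v x)),
          mul_nonneg (by linarith : (0:ℝ) ≤ M1 + q) (sq_nonneg (w x - v x))]
      have t2 : 2 * q2 * (y x * z x) ≤ M2 * (y x ^ 2 + z x ^ 2) := by
        nlinarith [mul_nonneg (by linarith : (0:ℝ) ≤ M2 - q2) (sq_nonneg (y x + z x)),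
          mul_nonneg (by linarith : (0:ℝ) ≤ M2 + q2) (sq_nonneg (y x - z x))]
      have p1 : 0 ≤ M1 := by linarith
      have p2 : 0 ≤ M2 := by linarith
      have s1 := mul_nonneg p1 (add_nonneg (sq_nonneg (y x)) (sq_nonneg (z x)))
      have s2 := mul_nonneg p2 (add_nonneg (sq_nonneg (w x)) (sq_nonneg (v x)))
      rw [hK]
      nlinarith [sq_nonneg (y x - v x), sq_nonneg (w x - z x), sq_nonneg (y x + v x),
        sq_nonneg (w x + z x)]
    linarith)
  intro x hx
  have := hmono (left_mem_Icc.2 ha.2) hx hx.1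
  simp only [hy, hv, hw, hz] at this
  have he := Real.exp_pos (-K * x)
  have h0 : Real.exp (-K * x) * (y x * y x + v x * v x + (w x * w x + z x * z x)) ≤ 0 := by
    linarith
  have h1 : y x * y x + v x * v x + (w x * w x + z x * z x) ≤ 0 := by
    by_contra hcon
    exact absurd h0 (not_le.2 (mul_pos he (not_le.1 hcon)))
  nlinarith [mul_self_nonneg (y x), mul_self_nonneg (v x), mul_self_nonneg (w x),
    mul_self_nonneg (z x)]

theorem uniq {p r y v w z : ℝ → ℝ} {l : ℝ} (hc : Coef p r)
    (h : Sy p r (fun x => l * y x) y v w z) {a : ℝ} (ha : a ∈ Icc (0:ℝ) 1)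
    (hy : y a = 0) (hv : v a = 0) (hw : w a = 0) (hz : z a = 0) : ∀ x ∈ Icc (0:ℝ) 1, y x = 0 := by
  intro x hx
  rcases le_total a x with hax | hax
  · exact uniq_right hc h ha hy hv hw hz x ⟨hax, hx.2⟩
  · have := uniq_right hc.refl h.refl (a := 1 - a) (refl_mem ha) (by simpa using hy)
      (by simpa using hv) (by simpa using hw) (by simpa using hz) (1 - x)
      ⟨by linarith, by linarith [hx.1]⟩
    simpa using this

/-- Nontrivial clamped solutions have only simple interior zeros. -/
theorem simple_zero {p r y v w z : ℝ → ℝ} {l : ℝ} (hc : Coef p r) (hl : 0 < l)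
    (h : Cl p r (fun x => l * y x) y v w z) (hnt : Nontriv y) {a : ℝ} (ha : a ∈ Ioo (0:ℝ) 1)
    (hy : y a = 0) : v a ≠ 0 := by
  intro hv
  have hne : w a ≠ 0 ∨ z a ≠ 0 := by
    by_contra hcon
    push Not at hcon
    obtain ⟨x, hx, hxn⟩ := hnt
    exact hxn (uniq hc h.toSy (Ioo_subset_Icc_self ha) hy hv hcon.1 hcon.2 x hx)
  have h' := (h.smul (-1)).congr (f' := fun x => l * (-1 * y x)) (fun x _ => by ring)
  rcases le_total 0 (w a) with hw | hw <;> rcases le_total 0 (z a) with hz | hz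
  · exact absurd h.y1 (LN_right hc hl h.toSy ha.1.le ha.2 hy hv hw hz hne).ne'
  · exact absurd h.y0 (LN_left hc hl h.toSy ha.1 ha.2.le hy hv hw hz hne).ne'
  · exact absurd h'.y0 (LN_left hc hl h'.toSy ha.1 ha.2.le (by simp [hy]) (by simp [hv])
      (by simpa using hw) (by simpa using hz) (by simpa using hne)).ne'
  · exact absurd h'.y1 (LN_right hc hl h'.toSy ha.1.le ha.2 (by simp [hy]) (by simp [hv])
      (by simpa using hw) (by simpa using hz) (by simpa using hne)).ne'

theorem w0_ne {p r y v w z : ℝ → ℝ} {l : ℝ} (hc : Coef p r) (hl : 0 < l)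
    (h : Cl p r (fun x => l * y x) y v w z) (hnt : Nontriv y) : w 0 ≠ 0 := by
  intro hw
  have hz0 : z 0 ≠ 0 := by
    intro hz
    obtain ⟨x, hx, hxn⟩ := hnt
    exact hxn (uniq hc h.toSy ⟨le_rfl, zero_le_one⟩ h.y0 h.v0 hw hz x hx)
  have h' := (h.smul (-1)).congr (f' := fun x => l * (-1 * y x)) (fun x _ => by ring)
  rcases le_total 0 (z 0) with hz | hz
  · exact absurd h.y1 (LN_right hc hl h.toSy le_rfl one_pos h.y0 h.v0 hw.ge hz (Or.inr hz0)).ne'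
  · exact absurd h'.y1 (LN_right hc hl h'.toSy le_rfl one_pos h'.y0 h'.v0 (by simp [hw])
      (by simpa using hz) (by simpa using Or.inr hz0)).ne'

theorem w1_ne {p r y v w z : ℝ → ℝ} {l : ℝ} (hc : Coef p r) (hl : 0 < l)
    (h : Cl p r (fun x => l * y x) y v w z) (hnt : Nontriv y) : w 1 ≠ 0 := by
  have h' : Cl _ _ _ _ _ _ _ := ⟨h.toSy.refl, by simp [h.y1], by simp [h.v1], by simp [h.y0],
    by simp [h.v0]⟩
  have := w0_ne hc.refl hl h' (by
    obtain ⟨x, hx, hxn⟩ := hnt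
    exact ⟨1 - x, refl_mem hx, by simpa using hxn⟩)
  simpa using this

/-- Eigenvalues are simple. -/
theorem simple_eig {p r y v w z y' v' w' z' : ℝ → ℝ} {l : ℝ} (hc : Coef p r) (hl : 0 < l)
    (h : Cl p r (fun x => l * y x) y v w z) (hnt : Nontriv y)
    (h' : Cl p r (fun x => l * y' x) y' v' w' z') :
    ∃ c, ∀ x ∈ Icc (0:ℝ) 1, y' x = c * y x := by
  have hw := w0_ne hc hl h hnt
  have H := ((h.smul (-w' 0)).add (h'.smul (w 0))).congr
    (f' := fun x => l * (-w' 0 * y x + w 0 * y' x)) (fun x _ => by ring)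
  have hz : ¬ Nontriv (fun x => -w' 0 * y x + w 0 * y' x) := fun hn =>
    w0_ne hc hl H hn (by ring)
  refine ⟨w' 0 / w 0, fun x hx => ?_⟩
  by_contra hcon
  refine hz ⟨x, hx, fun h0 => hcon ?_⟩
  field_simp
  linarith

/-! ### Weighted inner products -/

/-- Weighted inner product on `[0,1]`. -/
noncomputable def ip (ρ f g : ℝ → ℝ) : ℝ := ∫ x in (0:ℝ)..1, ρ x * (f x * g x)

theorem ip_comm (ρ f g : ℝ → ℝ) : ip ρ f g = ip ρ g f := by
  unfold ip; congr 1; ext x; ring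

theorem ip_congr {ρ f g f' g' : ℝ → ℝ} (h : ∀ x ∈ Icc (0:ℝ) 1, f x = f' x)
    (h' : ∀ x ∈ Icc (0:ℝ) 1, g x = g' x) : ip ρ f g = ip ρ f' g' := by
  unfold ip
  apply intervalIntegral.integral_congr
  intro x hx
  rw [uIcc_of_le zero_le_one] at hx
  simp only [h x hx, h' x hx]

theorem ip_ii {ρ f g : ℝ → ℝ} (hρ : ContinuousOn ρ (Icc 0 1)) (hf : ContinuousOn f (Icc 0 1))
    (hg : ContinuousOn g (Icc 0 1)) :
    IntervalIntegrable (fun x => ρ x * (f x * g x)) volume 0 1 :=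
  (hρ.mul (hf.mul hg)).intervalIntegrable_of_Icc zero_le_one

theorem ip_add {ρ f f' g : ℝ → ℝ} (hρ : ContinuousOn ρ (Icc 0 1)) (hf : ContinuousOn f (Icc 0 1))
    (hf' : ContinuousOn f' (Icc 0 1)) (hg : ContinuousOn g (Icc 0 1)) :
    ip ρ (fun x => f x + f' x) g = ip ρ f g + ip ρ f' g := by
  unfold ip
  rw [← intervalIntegral.integral_add (ip_ii hρ hf hg) (ip_ii hρ hf' hg)]
  congr 1; ext x; ring

theorem ip_smul (ρ f g : ℝ → ℝ) (c : ℝ) : ip ρ (fun x => c * f x) g = c * ip ρ f g := by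
  unfold ip
  rw [← intervalIntegral.integral_const_mul]
  congr 1; ext x; ring

theorem ip_smul_right (ρ f g : ℝ → ℝ) (c : ℝ) : ip ρ f (fun x => c * g x) = c * ip ρ f g := by
  rw [ip_comm, ip_smul, ip_comm]

theorem ip_add_right {ρ f f' g : ℝ → ℝ} (hρ : ContinuousOn ρ (Icc 0 1))
    (hf : ContinuousOn f (Icc 0 1))
    (hf' : ContinuousOn f' (Icc 0 1)) (hg : ContinuousOn g (Icc 0 1)) :
    ip ρ g (fun x => f x + f' x) = ip ρ g f + ip ρ g f' := by
  rw [ip_comm, ip_add hρ hf hf' hg, ip_comm ρ f, ip_comm ρ f']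

theorem ip_self_nonneg {ρ : ℝ → ℝ} (hρ : ∀ x ∈ Icc (0:ℝ) 1, 0 < ρ x) (f : ℝ → ℝ) :
    0 ≤ ip ρ f f :=
  intervalIntegral.integral_nonneg zero_le_one fun x hx =>
    mul_nonneg (hρ x hx).le (mul_self_nonneg _)

theorem ip_self_zero {ρ f : ℝ → ℝ} (hρc : ContinuousOn ρ (Icc 0 1))
    (hρ : ∀ x ∈ Icc (0:ℝ) 1, 0 < ρ x) (hf : ContinuousOn f (Icc 0 1)) (h : ip ρ f f = 0) :
    ∀ x ∈ Icc (0:ℝ) 1, f x = 0 := by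
  intro x hx
  by_contra hne
  have : 0 < ip ρ f f := intervalIntegral.integral_pos one_pos (hρc.mul (hf.mul hf))
    (fun t ht => mul_nonneg (hρ t (Ioc_subset_Icc_self ht)).le (mul_self_nonneg _))
    ⟨x, hx, mul_pos (hρ x hx) (mul_self_pos.2 hne)⟩
  linarith

theorem ip_cs {ρ f g : ℝ → ℝ} (hρc : ContinuousOn ρ (Icc 0 1))
    (hρ : ∀ x ∈ Icc (0:ℝ) 1, 0 < ρ x) (hf : ContinuousOn f (Icc 0 1))
    (hg : ContinuousOn g (Icc 0 1)) : ip ρ f g ^ 2 ≤ ip ρ f f * ip ρ g g := by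
  have key : ∀ t : ℝ, 0 ≤ ip ρ f f * (t * t) + (2 * ip ρ f g) * t + ip ρ g g := by
    intro t
    have h0 := ip_self_nonneg hρ (fun x => t * f x + g x)
    have htf : ContinuousOn (fun x => t * f x) (Icc 0 1) := continuousOn_const.mul hf
    have htg : ContinuousOn (fun x => t * f x + g x) (Icc 0 1) := htf.add hg
    rw [ip_add hρc htf hg htg, ip_add_right hρc htf hg htf, ip_add_right hρc htf hg hg,
      ip_smul, ip_smul, ip_smul_right, ip_smul_right, ip_comm ρ g f] at h0
    linarith
  have := discrim_le_zero key
  unfold discrim at this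
  linarith

theorem ip_le {ρ f : ℝ → ℝ} {B : ℝ} (hρc : ContinuousOn ρ (Icc 0 1))
    (hρ : ∀ x ∈ Icc (0:ℝ) 1, 0 < ρ x) (hf : ContinuousOn f (Icc 0 1))
    (hB : ∀ x ∈ Icc (0:ℝ) 1, f x ^ 2 ≤ B) : ip ρ f f ≤ B * ip ρ 1 1 := by
  rw [← ip_smul]
  apply intervalIntegral.integral_mono_on zero_le_one (ip_ii hρc hf hf)
    (ip_ii hρc (continuousOn_const.mul continuousOn_const) continuousOn_const)
  intro x hx
  apply mul_le_mul_of_nonneg_left _ (hρ x hx).le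
  have h1 := hB x hx
  have h2 : f x * f x ≤ B * 1 * 1 := by linarith [sq (f x)]
  exact h2

/-! ### Energy identity and bounds -/

theorem Coef.qc {p r : ℝ → ℝ} (hc : Coef p r) : ContinuousOn (fun x => 1 / p x) (Icc 0 1) :=
  continuousOn_const.div hc.pc fun x hx => (hc.pp x hx).ne'

theorem Coef.qp {p r : ℝ → ℝ} (hc : Coef p r) : ∀ x ∈ Icc (0:ℝ) 1, 0 < (fun x => 1 / p x) x :=
  fun x hx => one_div_pos.2 (hc.pp x hx)

theorem energy {p r f y v w z g h hv hw hz : ℝ → ℝ} (hc : Coef p r)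
    (hf : ContinuousOn f (Icc 0 1)) (H : Cl p r f y v w z) (G : Cl p r g h hv hw hz) :
    ip r f h = ip (fun x => 1 / p x) w hw := by
  have D := (H.dz.mul G.dy).add ((H.dw.mul G.dv).smul (-1))
  have C1 : ContinuousOn (fun x => r x * (f x * h x)) (Icc 0 1) :=
    hc.rc.mul (hf.mul G.dy.cont)
  have C2 : ContinuousOn (fun x => 1 / p x * (w x * hw x)) (Icc 0 1) :=
    hc.qc.mul (H.dw.cont.mul G.dw.cont)
  have D' : HD _ (fun x => r x * (f x * h x) - 1 / p x * (w x * hw x)) :=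
    D.congr fun x _ => by ring
  have := D'.ftc (C1.sub C2)
  rw [intervalIntegral.integral_sub (C1.intervalIntegrable_of_Icc zero_le_one)
    (C2.intervalIntegrable_of_Icc zero_le_one)] at this
  simp only [G.y0, G.y1, G.v0, G.v1] at this
  unfold ip
  linarith

theorem symm_ip {p r f y v w z g h hv hw hz : ℝ → ℝ} (hc : Coef p r)
    (hf : ContinuousOn f (Icc 0 1)) (hg : ContinuousOn g (Icc 0 1))
    (H : Cl p r f y v w z) (G : Cl p r g h hv hw hz) :
    ip r f h = ip r g y := by
  rw [energy hc hf H G, energy hc hg G H, ip_comm]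

theorem HD.lip {y v : ℝ → ℝ} (h : HD y v) {V : ℝ} (hV : ∀ x ∈ Icc (0:ℝ) 1, |v x| ≤ V) {x t : ℝ}
    (hx : x ∈ Icc (0:ℝ) 1) (ht : t ∈ Icc (0:ℝ) 1) : |y t - y x| ≤ V * |t - x| :=
  Convex.norm_image_sub_le_of_norm_hasDerivWithin_le (fun u hu => h u hu) hV (convex_Icc 0 1) hx ht

theorem v_bound {p r f y v w z : ℝ → ℝ} (hc : Coef p r) (H : Cl p r f y v w z) :
    ∀ x ∈ Icc (0:ℝ) 1, v x ^ 2 ≤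
      ip (fun x => 1 / p x) w w * ip (fun x => 1 / p x) 1 1 := by
  have hwa : ContinuousOn (fun x => |w x|) (Icc 0 1) := H.dw.cont.abs
  have hcon : ContinuousOn (fun x => 1 / p x * (|w x| * (1 : ℝ → ℝ) x)) (Icc 0 1) :=
    hc.qc.mul (hwa.mul continuousOn_const)
  obtain ⟨ψ, hψ, hψ0⟩ := exists_prim hcon
  have hψ1 : ψ 1 = ip (fun x => 1 / p x) (fun x => |w x|) 1 := by
    have := hψ.ftc hcon
    unfold ip; rw [this, hψ0]; ring
  have hcs := ip_cs hc.qc hc.qp hwa (g := 1) continuousOn_const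
  have e : ip (fun x => 1 / p x) (fun x => |w x|) (fun x => |w x|) =
      ip (fun x => 1 / p x) w w := by
    unfold ip; congr 1; ext x; rw [abs_mul_abs_self]
  rw [e, ← hψ1] at hcs
  intro x hx
  refine le_trans ?_ hcs
  have aux : ∀ t ∈ Ioo (0:ℝ) 1, |w t / p t| = 1 / p t * (|w t| * (1 : ℝ → ℝ) t) := by
    intro t ht
    rw [abs_div, abs_of_pos (hc.pp t (Ioo_subset_Icc_self ht))]
    simp; ring
  have m1 := (hψ.add H.dv).mono le_rfl le_rfl (fun t ht => by
    have := neg_abs_le (w t / p t); rw [aux t ht] at this; linarith)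
  have m2 := (hψ.add (H.dv.smul (-1))).mono le_rfl le_rfl (fun t ht => by
    have := le_abs_self (w t / p t); rw [aux t ht] at this; linarith)
  have m3 := hψ.mono le_rfl le_rfl (fun t ht => by
    rw [← aux t ht]; exact abs_nonneg _)
  have a1 := m1 (left_mem_Icc.2 zero_le_one) hx hx.1
  have a2 := m2 (left_mem_Icc.2 zero_le_one) hx hx.1
  have a3 := m3 hx (right_mem_Icc.2 zero_le_one) hx.2
  simp only [hψ0, H.v0] at a1 a2
  apply sq_le_sq'  <;> linarith

theorem y_bound {p r f y v w z : ℝ → ℝ} (H : Cl p r f y v w z) {B : ℝ}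
    (hB : ∀ x ∈ Icc (0:ℝ) 1, v x ^ 2 ≤ B) : ∀ x ∈ Icc (0:ℝ) 1, y x ^ 2 ≤ B := by
  intro x hx
  have hB0 : 0 ≤ B := (sq_nonneg _).trans (hB x hx)
  have := H.dy.lip (V := √B) (fun t ht => Real.abs_le_sqrt (hB t ht))
    (left_mem_Icc.2 zero_le_one) hx
  rw [H.y0, sub_zero, sub_zero, abs_of_nonneg hx.1] at this
  have h1 : |y x| ≤ √B := this.trans (mul_le_of_le_one_right (Real.sqrt_nonneg _) hx.2)
  rw [← sq_abs, ← Real.sq_sqrt hB0]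
  exact pow_le_pow_left₀ (abs_nonneg _) h1 2

theorem bounds {p r : ℝ → ℝ} (hc : Coef p r) : ∃ C : ℝ, 0 ≤ C ∧
    ∀ f y v w z : ℝ → ℝ, ContinuousOn f (Icc 0 1) → Cl p r f y v w z →
      ∀ x ∈ Icc (0:ℝ) 1, v x ^ 2 ≤ C * ip r f f ∧ y x ^ 2 ≤ C * ip r f f := by
  set P := ip (fun x => 1 / p x) 1 1
  set R := ip r 1 1
  have hP : 0 ≤ P := ip_self_nonneg hc.qp _
  have hR : 0 ≤ R := ip_self_nonneg hc.rp _
  refine ⟨P * (P * R), by positivity, fun f y v w z hf H => ?_⟩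
  set E := ip (fun x => 1 / p x) w w
  have hE : 0 ≤ E := ip_self_nonneg hc.qp _
  have hF : 0 ≤ ip r f f := ip_self_nonneg hc.rp _
  have hv := v_bound hc H
  have hy := y_bound H hv
  have hyy := ip_le hc.rc hc.rp H.dy.cont hy
  have hen : ip r f y = E := energy hc hf H H
  have hcs := ip_cs hc.rc hc.rp hf H.dy.cont
  rw [hen] at hcs
  have hE2 : E ≤ ip r f f * P * R := by
    rcases hE.lt_or_eq with h | h
    · have : E * E ≤ (ip r f f * P * R) * E := by
        calc E * E = E ^ 2 := by ring
          _ ≤ ip r f f * ip r y y := hcs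
          _ ≤ ip r f f * (E * P * R) := mul_le_mul_of_nonneg_left hyy hF
          _ = _ := by ring
      exact le_of_mul_le_mul_right this h
    · rw [← h]; positivity
  have : E * P ≤ P * (P * R) * ip r f f := by
    calc E * P ≤ (ip r f f * P * R) * P := mul_le_mul_of_nonneg_right hE2 hP
      _ = _ := by ring
  exact fun x hx => ⟨(hv x hx).trans this, (hy x hx).trans this⟩

theorem eig_pos {p r y v w z : ℝ → ℝ} {l : ℝ} (hc : Coef p r)
    (H : Cl p r (fun x => l * y x) y v w z) (hnt : Nontriv y) : 0 < l := by
  have hf : ContinuousOn (fun x => l * y x) (Icc 0 1) := continuousOn_const.mul H.dy.cont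
  have hen := energy hc hf H H
  rw [ip_smul] at hen
  have hv := v_bound hc H
  have hy := y_bound H hv
  obtain ⟨x, hx, hxn⟩ := hnt
  have h1 := hy x hx
  rw [← hen] at h1
  have hP : 0 ≤ ip (fun x => 1 / p x) 1 1 := ip_self_nonneg hc.qp _
  have hY : 0 ≤ ip r y y := ip_self_nonneg hc.rp _
  have h2 : 0 < y x ^ 2 := by positivity
  by_contra hl
  have : l * ip r y y ≤ 0 := mul_nonpos_of_nonpos_of_nonneg (not_lt.1 hl) hY
  nlinarith [mul_nonpos_of_nonpos_of_nonneg this hP]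

/-! ### Solvability of the clamped problem -/

theorem exists_Sy {p r f : ℝ → ℝ} (hc : Coef p r) (hf : ContinuousOn f (Icc 0 1)) (A B : ℝ) :
    ∃ y v w z, Sy p r f y v w z ∧ y 0 = 0 ∧ v 0 = 0 ∧ w 0 = A ∧ z 0 = B := by
  obtain ⟨z, hz, hz0⟩ := exists_prim (hc.rc.mul hf)
  have hz' : HD (fun x => z x + B) (fun x => r x * f x) := fun x hx => (hz x hx).add_const B
  obtain ⟨w, hw, hw0⟩ := exists_prim hz'.cont
  have hw' : HD (fun x => w x + A) (fun x => z x + B) := fun x hx => (hw x hx).add_const A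
  obtain ⟨v, hv, hv0⟩ := exists_prim (hw'.cont.div hc.pc fun x hx => (hc.pp x hx).ne')
  obtain ⟨y, hy, hy0⟩ := exists_prim hv.cont
  exact ⟨y, v, _, _, ⟨hy, hv, hw', hz'⟩, hy0, hv0, by simp [hw0], by simp [hz0]⟩

theorem Cl_zero {p r y v w z : ℝ → ℝ} (hc : Coef p r) (H : Cl p r (fun _ => 0) y v w z) :
    w 0 = 0 ∧ z 0 = 0 := by
  have h1 := energy hc continuousOn_const H H
  have h2 : ip (fun x => 1 / p x) w w = 0 := by
    rw [← h1]; simp [ip]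
  have hw := ip_self_zero hc.qc hc.qp H.dw.cont h2
  refine ⟨hw 0 (left_mem_Icc.2 zero_le_one), ?_⟩
  have h0 : (0:ℝ) ∈ Icc (0:ℝ) 1 := left_mem_Icc.2 zero_le_one
  have d1 := H.dw 0 h0
  have d2 : HasDerivWithinAt w 0 (Icc 0 1) 0 :=
    (hasDerivWithinAt_const (0:ℝ) (Icc (0:ℝ) 1) (0:ℝ)).congr hw (hw 0 h0)
  exact (uniqueDiffOn_Icc one_pos 0 h0).eq_deriv _ d1 d2

theorem exists_Cl {p r f : ℝ → ℝ} (hc : Coef p r) (hf : ContinuousOn f (Icc 0 1)) :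
    ∃ y v w z, Cl p r f y v w z := by
  obtain ⟨y0, v0, w0, z0, h0, hy0, hv0, -, -⟩ := exists_Sy hc hf 0 0
  obtain ⟨y1, v1, w1, z1, h1, hy1, hv1, hw1, hz1⟩ :=
    exists_Sy hc (f := fun _ => 0) continuousOn_const 1 0
  obtain ⟨y2, v2, w2, z2, h2, hy2, hv2, hw2, hz2⟩ :=
    exists_Sy hc (f := fun _ => 0) continuousOn_const 0 1
  have inj : ∀ a b : ℝ, a * y1 1 + b * y2 1 = 0 → a * v1 1 + b * v2 1 = 0 → a = 0 ∧ b = 0 := by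
    intro a b ha hb
    have S : Cl p r (fun _ => 0) _ _ _ _ :=
      ⟨((h1.smul a).add (h2.smul b)).congr (fun x _ => by simp), by simp [hy1, hy2],
        by simp [hv1, hv2], ha, hb⟩
    have := Cl_zero hc S
    simpa [hw1, hw2, hz1, hz2] using this
  have det : y1 1 * v2 1 - y2 1 * v1 1 ≠ 0 := by
    intro hd
    have e1 := inj (y2 1) (-y1 1) (by ring) (by linarith)
    have e2 := inj (v2 1) (-v1 1) (by linarith) (by ring)
    have := inj 1 0 (by linarith [e1.2]) (by linarith [e2.2])
    exact one_ne_zero this.1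
  set d := y1 1 * v2 1 - y2 1 * v1 1
  set a := (y2 1 * v0 1 - v2 1 * y0 1) / d with ha
  set b := (v1 1 * y0 1 - y1 1 * v0 1) / d with hb
  refine ⟨_, _, _, _, ⟨(h0.add ((h1.smul a).add (h2.smul b))).congr (fun x _ => by simp),
    by simp [hy0, hy1, hy2], by simp [hv0, hv1, hv2], ?_, ?_⟩⟩
  · have : y0 1 + (a * y1 1 + b * y2 1) = 0 := by
      rw [ha, hb]; field_simp; simp only [d]; ring
    exact this
  · have : v0 1 + (a * v1 1 + b * v2 1) = 0 := by
      rw [ha, hb]; field_simp; simp only [d]; ring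
    exact this

/-! ### Relation with the definitions of the statement -/

theorem HD.Dv {f g : ℝ → ℝ} (h : HD f g) {x : ℝ} (hx : x ∈ Icc (0:ℝ) 1) : Dv f x = g x :=
  (h x hx).derivWithin (uniqueDiffOn_Icc one_pos x hx)

theorem HD_Dv {f : ℝ → ℝ} (h : DifferentiableOn ℝ f (Icc 0 1)) : HD f (Dv f) :=
  fun x hx => (h x hx).hasDerivWithinAt

theorem Dv_congr {f g : ℝ → ℝ} (h : ∀ x ∈ Icc (0:ℝ) 1, f x = g x) {x : ℝ}
    (hx : x ∈ Icc (0:ℝ) 1) : Dv f x = Dv g x :=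
  derivWithin_congr h (h x hx)

theorem contDiff_two {f : ℝ → ℝ} : ContDiffOn ℝ 2 f (Icc 0 1) ↔
    DifferentiableOn ℝ f (Icc 0 1) ∧ DifferentiableOn ℝ (Dv f) (Icc 0 1) ∧
      ContinuousOn (Dv (Dv f)) (Icc 0 1) := by
  have hu : UniqueDiffOn ℝ (Icc (0:ℝ) 1) := uniqueDiffOn_Icc one_pos
  rw [show (2 : WithTop ℕ∞) = 1 + 1 from (one_add_one_eq_two).symm,
    contDiffOn_succ_iff_derivWithin hu, show (1 : WithTop ℕ∞) = 0 + 1 from (zero_add 1).symm,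
    contDiffOn_succ_iff_derivWithin hu, contDiffOn_zero]
  simp [_root_.Dv]

theorem Cl_of_SolS {p r y : ℝ → ℝ} {l : ℝ} (hc : Coef p r) (h : SolS p r l y) (hb : BC1 y) :
    Cl p r (fun x => l * y x) y (Dv y) (fun x => p x * Dv (Dv y) x)
      (Dv (fun x => p x * Dv (Dv y) x)) := by
  obtain ⟨h1, h2, h3⟩ := h
  rw [contDiff_two] at h1 h2
  refine ⟨⟨HD_Dv h1.1, (HD_Dv h1.2.1).congr fun x hx => ?_, HD_Dv h2.1,
    (HD_Dv h2.2.1).congr fun x hx => ?_⟩, hb.1, hb.2.1, hb.2.2.1, hb.2.2.2⟩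
  · rw [mul_div_cancel_left₀ _ (hc.pp x hx).ne']
  · rw [h3 x hx]; ring

theorem EigS1_of_Cl {p r y v w z : ℝ → ℝ} {l : ℝ} (hc : Coef p r)
    (H : Cl p r (fun x => l * y x) y v w z) (hnt : Nontriv y) : EigS1 p r l := by
  have e1 : ∀ x ∈ Icc (0:ℝ) 1, Dv y x = v x := fun x hx => H.dy.Dv hx
  have e2 : ∀ x ∈ Icc (0:ℝ) 1, Dv (Dv y) x = w x / p x := fun x hx => by
    rw [Dv_congr e1 hx, H.dv.Dv hx]
  have e3 : ∀ x ∈ Icc (0:ℝ) 1, p x * Dv (Dv y) x = w x := fun x hx => by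
    rw [e2 x hx, mul_div_cancel₀ _ (hc.pp x hx).ne']
  have e4 : ∀ x ∈ Icc (0:ℝ) 1, Dv (fun t => p t * Dv (Dv y) t) x = z x := fun x hx => by
    rw [Dv_congr e3 hx, H.dw.Dv hx]
  have e5 : ∀ x ∈ Icc (0:ℝ) 1, Dv (Dv (fun t => p t * Dv (Dv y) t)) x = r x * (l * y x) :=
    fun x hx => by rw [Dv_congr e4 hx, H.dz.Dv hx]
  have dd : ∀ {f g : ℝ → ℝ}, HD f g → DifferentiableOn ℝ f (Icc 0 1) :=
    fun h x hx => (h x hx).differentiableWithinAt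
  have m0 : (0:ℝ) ∈ Icc (0:ℝ) 1 := left_mem_Icc.2 zero_le_one
  have m1 : (1:ℝ) ∈ Icc (0:ℝ) 1 := right_mem_Icc.2 zero_le_one
  refine ⟨y, ⟨contDiff_two.2 ⟨dd H.dy, (dd H.dv).congr e1, ?_⟩,
    contDiff_two.2 ⟨(dd H.dw).congr e3, (dd H.dz).congr e4, ?_⟩, fun x hx => ?_⟩, hnt,
    H.y0, by rw [e1 0 m0, H.v0], H.y1, by rw [e1 1 m1, H.v1]⟩
  · exact (H.dw.cont.div hc.pc fun x hx => (hc.pp x hx).ne').congr e2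
  · exact (hc.rc.mul (continuousOn_const.mul H.dy.cont)).congr e5
  · rw [e5 x hx]; ring

/-! ### Counting zeros -/

/-- `f` has at least `N` distinct zeros in `(0,1)`. -/
def ZGe (f : ℝ → ℝ) (N : ℕ) : Prop :=
  ∃ s : Finset ℝ, (∀ x ∈ s, x ∈ Ioo (0:ℝ) 1) ∧ (∀ x ∈ s, f x = 0) ∧ N ≤ s.card

theorem rolle_count {f g : ℝ → ℝ} (h : HD f g) {s : Finset ℝ} (hs : ∀ x ∈ s, x ∈ Icc (0:ℝ) 1)
    (hf : ∀ x ∈ s, f x = 0) {N : ℕ} (hN : N + 1 ≤ s.card) : ZGe g N := by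
  by_cases hfin : {x ∈ Ioo (0:ℝ) 1 | g x = 0}.Finite
  · refine ⟨hfin.toFinset, fun x hx => ((hfin.mem_toFinset).1 hx).1,
      fun x hx => ((hfin.mem_toFinset).1 hx).2, ?_⟩
    have := Finset.card_le_of_interleaved (s := s) (t := hfin.toFinset) (by
      intro x hx y hy hxy _
      obtain ⟨c, hcm, hcz⟩ := h.rolle (hs x hx) (hs y hy) hxy (by rw [hf x hx, hf y hy])
      exact ⟨c, hfin.mem_toFinset.2 ⟨⟨(hs x hx).1.trans_lt hcm.1, hcm.2.trans_le (hs y hy).2⟩, hcz⟩,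
        hcm.1, hcm.2⟩)
    omega
  · obtain ⟨t, ht, htc⟩ := Set.Infinite.exists_subset_card_eq hfin N
    exact ⟨t, fun x hx => (ht hx).1, fun x hx => (ht hx).2, htc.ge⟩

theorem rolle_inner {f g : ℝ → ℝ} (h : HD f g) {N : ℕ} (hN : ZGe f (N + 1)) : ZGe g N := by
  obtain ⟨s, hs, hf, hc⟩ := hN
  exact rolle_count h (fun x hx => Ioo_subset_Icc_self (hs x hx)) hf hc

theorem rolle_ends {f g : ℝ → ℝ} (h : HD f g) (h0 : f 0 = 0) (h1 : f 1 = 0) {N : ℕ}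
    (hN : ZGe f N) : ZGe g (N + 1) := by
  obtain ⟨s, hs, hf, hc⟩ := hN
  have n1 : (1:ℝ) ∉ s := fun hm => (lt_irrefl _ (hs 1 hm).2)
  have n0 : (0:ℝ) ∉ insert 1 s := by
    intro hm
    rcases Finset.mem_insert.1 hm with h | h
    · exact zero_ne_one h
    · exact lt_irrefl _ (hs 0 h).1
  refine rolle_count h (s := insert 0 (insert 1 s)) ?_ ?_ ?_
  · intro x hx
    rcases Finset.mem_insert.1 hx with rfl | hx
    · exact left_mem_Icc.2 zero_le_one
    rcases Finset.mem_insert.1 hx with rfl | hx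
    · exact right_mem_Icc.2 zero_le_one
    · exact Ioo_subset_Icc_self (hs x hx)
  · intro x hx
    rcases Finset.mem_insert.1 hx with rfl | hx
    · exact h0
    rcases Finset.mem_insert.1 hx with rfl | hx
    · exact h1
    · exact hf x hx
  · rw [Finset.card_insert_of_notMem n0, Finset.card_insert_of_notMem n1]
    omega

theorem ZGe.map {f g : ℝ → ℝ} {N : ℕ} (h : ZGe f N) (e : ∀ x ∈ Ioo (0:ℝ) 1, f x = 0 → g x = 0) :
    ZGe g N := by
  obtain ⟨s, hs, hf, hc⟩ := h
  exact ⟨s, hs, fun x hx => e x (hs x hx) (hf x hx), hc⟩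

/-- The key Rolle argument. -/
theorem Cl.zeros {p r f y v w z : ℝ → ℝ} (hc : Coef p r) (H : Cl p r f y v w z) {N : ℕ}
    (h : ZGe y N) : ZGe f N := by
  have h1 := rolle_ends H.dy H.y0 H.y1 h
  have h2 := rolle_ends H.dv H.v0 H.v1 h1
  have h3 : ZGe w (N + 1 + 1) := h2.map fun x hx h0 => by
    rcases div_eq_zero_iff.1 h0 with h | h
    · exact h
    · exact absurd h (hc.pp x (Ioo_subset_Icc_self hx)).ne'
  have h4 := rolle_inner H.dz (rolle_inner H.dw h3)
  exact h4.map fun x hx h0 => by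
    rcases mul_eq_zero.1 h0 with h | h
    · exact absurd h (hc.rp x (Ioo_subset_Icc_self hx)).ne'
    · exact h

/-- A simple zero produces sign change arbitrarily close. -/
theorem sign_near {g : ℝ → ℝ} {x d : ℝ} (h : HasDerivAt g d x) (hd : 0 < d) (h0 : g x = 0)
    {U : Set ℝ} (hU : U ∈ 𝓝 x) :
    ∃ a b, a < b ∧ Icc a b ⊆ U ∧ g a < 0 ∧ 0 < g b := by
  have hs : ∀ᶠ t in 𝓝[≠] x, 0 < slope g x t := (hasDerivAt_iff_tendsto_slope.1 h).eventually
    (lt_mem_nhds hd)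
  rw [eventually_nhdsWithin_iff] at hs
  obtain ⟨e, he, hall⟩ := Metric.eventually_nhds_iff.1 (hs.and hU)
  have ha := hall (y := x - e / 2) (by rw [Real.dist_eq, abs_lt]; constructor <;> linarith)
  have hb := hall (y := x + e / 2) (by rw [Real.dist_eq, abs_lt]; constructor <;> linarith)
  have ha1 := ha.1 (by simp; linarith)
  have hb1 := hb.1 (by simp; linarith)
  rw [slope_def_field, h0] at ha1 hb1
  refine ⟨x - e / 2, x + e / 2, by linarith, fun t ht => ?_, ?_, ?_⟩
  · exact (hall (by rw [Real.dist_eq, abs_lt]; constructor <;> linarith [ht.1, ht.2])).2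
  · by_contra hcon
    refine absurd ha1 (not_lt.2 (div_nonpos_of_nonneg_of_nonpos (by linarith) (by linarith)))
  · by_contra hcon
    refine absurd hb1 (not_lt.2 (div_nonpos_of_nonpos_of_nonneg (by linarith) (by linarith)))

theorem persist_one {g : ℝ → ℝ} {x d : ℝ} (h : HasDerivAt g d x) (hd : d ≠ 0) (h0 : g x = 0)
    {U : Set ℝ} (hU : U ∈ 𝓝 x) (hx : x ∈ Ioo (0:ℝ) 1) {F : ℕ → ℝ → ℝ}
    (hF : ∀ k, ContinuousOn (F k) (Icc 0 1))
    (hlim : ∀ t ∈ Icc (0:ℝ) 1, Tendsto (fun k => F k t) atTop (𝓝 (g t))) :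
    ∀ᶠ k in atTop, ∃ t ∈ U ∩ Ioo (0:ℝ) 1, F k t = 0 := by
  have hU' : U ∩ Ioo (0:ℝ) 1 ∈ 𝓝 x := inter_mem hU (Ioo_mem_nhds hx.1 hx.2)
  rcases lt_or_gt_of_ne hd with hd | hd
  · obtain ⟨a, b, hab, hsub, ga, gb⟩ := sign_near h.neg (by linarith) (by simp [h0]) hU'
    have I : Icc a b ⊆ Icc 0 1 := fun t ht => Ioo_subset_Icc_self (hsub ht).2
    simp only [Pi.neg_apply] at ga gb
    have e1 := (hlim a (I (left_mem_Icc.2 hab.le))).eventually (lt_mem_nhds (by linarith : 0 < g a))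
    have e2 := (hlim b (I (right_mem_Icc.2 hab.le))).eventually (gt_mem_nhds (by linarith : g b < 0))
    filter_upwards [e1, e2] with k k1 k2
    obtain ⟨t, ht, ht0⟩ := intermediate_value_Icc' hab.le ((hF k).mono I) ⟨k2.le, k1.le⟩
    exact ⟨t, hsub ht, ht0⟩
  · obtain ⟨a, b, hab, hsub, ga, gb⟩ := sign_near h hd h0 hU'
    have I : Icc a b ⊆ Icc 0 1 := fun t ht => Ioo_subset_Icc_self (hsub ht).2
    have e1 := (hlim a (I (left_mem_Icc.2 hab.le))).eventually (gt_mem_nhds ga)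
    have e2 := (hlim b (I (right_mem_Icc.2 hab.le))).eventually (lt_mem_nhds gb)
    filter_upwards [e1, e2] with k k1 k2
    obtain ⟨t, ht, ht0⟩ := intermediate_value_Icc hab.le ((hF k).mono I) ⟨k1.le, k2.le⟩
    exact ⟨t, hsub ht, ht0⟩

/-- Simple zeros persist under pointwise limits of continuous functions. -/
theorem persist {g v : ℝ → ℝ} (h : HD g v) {N : ℕ} (hz : ZGe g N)
    (hs : ∀ x ∈ Ioo (0:ℝ) 1, g x = 0 → v x ≠ 0) {F : ℕ → ℝ → ℝ}
    (hF : ∀ k, ContinuousOn (F k) (Icc 0 1))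
    (hlim : ∀ t ∈ Icc (0:ℝ) 1, Tendsto (fun k => F k t) atTop (𝓝 (g t))) :
    ∀ᶠ k in atTop, ZGe (F k) N := by
  obtain ⟨s, hsI, hs0, hcard⟩ := hz
  obtain ⟨U, hU, hdisj⟩ := s.finite_toSet.t2_separation
  have ev : ∀ᶠ k in atTop, ∀ x ∈ s, ∃ t ∈ U x ∩ Ioo (0:ℝ) 1, F k t = 0 := by
    rw [Filter.eventually_all_finset]
    intro x hx
    exact persist_one (h.at (hsI x hx)) (hs x (hsI x hx) (hs0 x hx)) (hs0 x hx)
      ((hU x).2.mem_nhds (hU x).1) (hsI x hx) hF hlim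
  filter_upwards [ev] with k hk
  choose! τ hτ hτ0 using hk
  have hinj : Set.InjOn τ s := by
    intro x hx x' hx' he
    by_contra hne
    have := hdisj hx hx' hne
    exact Set.disjoint_left.1 this (hτ x hx).1 (he ▸ (hτ x' hx').1)
  refine ⟨s.image τ, ?_, ?_, ?_⟩
  · intro t ht
    obtain ⟨x, hx, rfl⟩ := Finset.mem_image.1 ht
    exact (hτ x hx).2
  · intro t ht
    obtain ⟨x, hx, rfl⟩ := Finset.mem_image.1 ht
    exact hτ0 x hx
  · rwa [Finset.card_image_of_injOn hinj]

/-- Uniform convergence on `[0,1]`. -/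
def UC (F : ℕ → ℝ → ℝ) (g : ℝ → ℝ) : Prop :=
  ∀ ε > 0, ∀ᶠ k in atTop, ∀ x ∈ Icc (0:ℝ) 1, |F k x - g x| < ε

theorem UC.ne_near {F : ℕ → ℝ → ℝ} {g : ℝ → ℝ} (h : UC F g) (hg : ContinuousOn g (Icc 0 1))
    {x : ℝ} (hx : x ∈ Icc (0:ℝ) 1) (hne : g x ≠ 0) :
    ∃ δ > 0, ∀ᶠ k in atTop, ∀ t ∈ Icc (0:ℝ) 1, |t - x| < δ → F k t ≠ 0 := by
  have he : 0 < |g x| / 2 := by positivity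
  obtain ⟨δ, hδ, hd⟩ := Metric.continuousOn_iff.1 hg x hx _ he
  refine ⟨δ, hδ, ?_⟩
  filter_upwards [h _ he] with k hk t ht htx h0
  have h1 := hd t ht htx
  have h2 := hk t ht
  rw [Real.dist_eq] at h1
  rw [h0, zero_sub, abs_neg] at h2
  have h3 : |g x| ≤ |g t - g x| + |g t| := by
    have := abs_sub_abs_le_abs_sub (g x) (g t)
    rw [abs_sub_comm] at this
    linarith
  linarith

/-- Zeros cannot disappear in a nondegenerate `C²` limit. -/
theorem zeros_limit {F V A : ℕ → ℝ → ℝ} {g v a : ℝ → ℝ}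
    (hFV : ∀ k, HD (F k) (V k)) (hVA : ∀ k, HD (V k) (A k))
    (hF0 : ∀ k, F k 0 = 0) (hV0 : ∀ k, V k 0 = 0) (hF1 : ∀ k, F k 1 = 0) (hV1 : ∀ k, V k 1 = 0)
    (ug : UC F g) (uv : UC V v) (ua : UC A a)
    (cg : ContinuousOn g (Icc 0 1)) (cv : ContinuousOn v (Icc 0 1)) (ca : ContinuousOn a (Icc 0 1))
    (hs : ∀ x ∈ Ioo (0:ℝ) 1, g x = 0 → v x ≠ 0) (ha0 : a 0 ≠ 0) (ha1 : a 1 ≠ 0)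
    {N : ℕ} (hz : ∀ k, ZGe (F k) N) : ZGe g N := by
  have m0 : (0:ℝ) ∈ Icc (0:ℝ) 1 := left_mem_Icc.2 zero_le_one
  have m1 : (1:ℝ) ∈ Icc (0:ℝ) 1 := right_mem_Icc.2 zero_le_one
  have loc : ∀ x ∈ Icc (0:ℝ) 1, ∃ δ > 0, ∀ᶠ k in atTop,
      ∀ t ∈ Ioo (0:ℝ) 1, |t - x| < δ → F k t = 0 → (x ∈ Ioo (0:ℝ) 1 ∧ g x = 0) ∧
        ∀ t' ∈ Ioo (0:ℝ) 1, |t' - x| < δ → F k t' = 0 → t = t' := by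
    intro x hx
    by_cases hgx : g x ≠ 0
    · obtain ⟨δ, hδ, ev⟩ := ug.ne_near cg hx hgx
      refine ⟨δ, hδ, ?_⟩
      filter_upwards [ev] with k hk t ht htx h0
      exact absurd h0 (hk t (Ioo_subset_Icc_self ht) htx)
    push Not at hgx
    by_cases hx0 : x = 0
    · subst hx0
      obtain ⟨δ, hδ, ev⟩ := ua.ne_near ca hx ha0
      refine ⟨δ, hδ, ?_⟩
      filter_upwards [ev] with k hk t ht htx h0
      exfalso
      obtain ⟨c, hcm, hc0⟩ := (hFV k).rolle m0 (Ioo_subset_Icc_self ht) ht.1 (by rw [hF0, h0])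
      have hcI : c ∈ Icc (0:ℝ) 1 := ⟨hcm.1.le, (hcm.2.trans ht.2).le⟩
      obtain ⟨e, hem, he0⟩ := (hVA k).rolle m0 hcI hcm.1 (by rw [hV0, hc0])
      refine hk e ⟨hem.1.le, hem.2.le.trans hcI.2⟩ ?_ he0
      rw [abs_lt] at htx ⊢
      constructor <;> linarith [hem.1, hem.2, hcm.2]
    by_cases hx1 : x = 1
    · subst hx1
      obtain ⟨δ, hδ, ev⟩ := ua.ne_near ca hx ha1
      refine ⟨δ, hδ, ?_⟩
      filter_upwards [ev] with k hk t ht htx h0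
      exfalso
      obtain ⟨c, hcm, hc0⟩ := (hFV k).rolle (Ioo_subset_Icc_self ht) m1 ht.2 (by rw [hF1, h0])
      have hcI : c ∈ Icc (0:ℝ) 1 := ⟨(ht.1.trans hcm.1).le, hcm.2.le⟩
      obtain ⟨e, hem, he0⟩ := (hVA k).rolle hcI m1 hcm.2 (by rw [hV1, hc0])
      refine hk e ⟨hcI.1.trans hem.1.le, hem.2.le⟩ ?_ he0
      rw [abs_lt] at htx ⊢
      constructor <;> linarith [hem.1, hem.2, hcm.1]
    have hxo : x ∈ Ioo (0:ℝ) 1 := ⟨lt_of_le_of_ne hx.1 (Ne.symm hx0), lt_of_le_of_ne hx.2 hx1⟩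
    obtain ⟨δ, hδ, ev⟩ := uv.ne_near cv hx (hs x hxo hgx)
    refine ⟨δ, hδ, ?_⟩
    filter_upwards [ev] with k hk t ht htx h0
    refine ⟨⟨hxo, hgx⟩, ?_⟩
    have aux : ∀ t ∈ Ioo (0:ℝ) 1, ∀ t' ∈ Ioo (0:ℝ) 1, |t - x| < δ → |t' - x| < δ → F k t = 0 →
        F k t' = 0 → ¬ t < t' := by
      intro t ht t' ht' htx htx' h0 h0' hlt
      obtain ⟨c, hcm, hc0⟩ := (hFV k).rolle (Ioo_subset_Icc_self ht) (Ioo_subset_Icc_self ht') hlt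
        (by rw [h0, h0'])
      refine hk c ⟨(ht.1.trans hcm.1).le, (hcm.2.trans ht'.2).le⟩ ?_ hc0
      rw [abs_lt] at htx htx' ⊢
      constructor <;> linarith [hcm.1, hcm.2]
    intro t' ht' htx' h0'
    exact le_antisymm (not_lt.1 (aux t' ht' t ht htx' htx h0' h0))
      (not_lt.1 (aux t ht t' ht' htx htx' h0 h0'))
  choose! δ hδ ev using loc
  obtain ⟨T, hTI, hTcov⟩ := isCompact_Icc.elim_nhds_subcover (s := Icc (0:ℝ) 1)
    (fun x => Metric.ball x (δ x)) (fun x hx => Metric.ball_mem_nhds x (hδ x hx))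
  have evT := (Filter.eventually_all_finset T).2 (fun x hx => ev x (hTI x hx))
  obtain ⟨k, hk⟩ := evT.exists
  obtain ⟨s, hsI, hs0, hsc⟩ := hz k
  have hch : ∀ t ∈ s, ∃ x ∈ T, |t - x| < δ x := by
    intro t ht
    have := hTcov (Ioo_subset_Icc_self (hsI t ht))
    simp only [mem_iUnion, Metric.mem_ball, Real.dist_eq] at this
    obtain ⟨x, hx, h⟩ := this
    exact ⟨x, hx, h⟩
  choose! σ hσT hσ using hch
  have hinj : Set.InjOn σ s := by
    intro t ht t' ht' he
    have e2 := hσ t' ht'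
    rw [← he] at e2
    exact (hk (σ t) (hσT t ht) t (hsI t ht) (hσ t ht) (hs0 t ht)).2 t' (hsI t' ht') e2 (hs0 t' ht')
  refine ⟨s.image σ, ?_, ?_, ?_⟩
  · intro x hx
    obtain ⟨t, ht, rfl⟩ := Finset.mem_image.1 hx
    exact (hk (σ t) (hσT t ht) t (hsI t ht) (hσ t ht) (hs0 t ht)).1.1
  · intro x hx
    obtain ⟨t, ht, rfl⟩ := Finset.mem_image.1 hx
    exact (hk (σ t) (hσT t ht) t (hsI t ht) (hσ t ht) (hs0 t ht)).1.2
  · rwa [Finset.card_image_of_injOn hinj]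

/-! ### Finite combinations of eigenfunctions -/

theorem Cl.sum {p r : ℝ → ℝ} {ι : Type*} (s : Finset ι) (d : ι → ℝ) {f y v w z : ι → ℝ → ℝ}
    (H : ∀ i ∈ s, Cl p r (f i) (y i) (v i) (w i) (z i)) :
    Cl p r (fun x => ∑ i ∈ s, d i * f i x) (fun x => ∑ i ∈ s, d i * y i x)
      (fun x => ∑ i ∈ s, d i * v i x) (fun x => ∑ i ∈ s, d i * w i x)
      (fun x => ∑ i ∈ s, d i * z i x) := by
  refine ⟨⟨fun x hx => ?_, fun x hx => ?_, fun x hx => ?_, fun x hx => ?_⟩, ?_, ?_, ?_, ?_⟩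
  · exact HasDerivWithinAt.fun_sum fun i hi => ((H i hi).dy x hx).const_mul (d i)
  · have e : (∑ i ∈ s, d i * w i x) / p x = ∑ i ∈ s, d i * (w i x / p x) := by
      rw [Finset.sum_div]
      exact Finset.sum_congr rfl fun i _ => by ring
    show HasDerivWithinAt _ ((∑ i ∈ s, d i * w i x) / p x) _ _
    rw [e]
    exact HasDerivWithinAt.fun_sum fun i hi => ((H i hi).dv x hx).const_mul (d i)
  · exact HasDerivWithinAt.fun_sum fun i hi => ((H i hi).dw x hx).const_mul (d i)
  · have e : r x * (∑ i ∈ s, d i * f i x) = ∑ i ∈ s, d i * (r x * f i x) := by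
      rw [Finset.mul_sum]
      exact Finset.sum_congr rfl fun i _ => by ring
    show HasDerivWithinAt _ (r x * (∑ i ∈ s, d i * f i x)) _ _
    rw [e]
    exact HasDerivWithinAt.fun_sum fun i hi => ((H i hi).dz x hx).const_mul (d i)
  · exact Finset.sum_eq_zero fun i hi => by rw [(H i hi).y0, mul_zero]
  · exact Finset.sum_eq_zero fun i hi => by rw [(H i hi).v0, mul_zero]
  · exact Finset.sum_eq_zero fun i hi => by rw [(H i hi).y1, mul_zero]
  · exact Finset.sum_eq_zero fun i hi => by rw [(H i hi).v1, mul_zero]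

theorem UC_top {ι : Type*} [DecidableEq ι] (s : Finset ι) (e c : ι → ℝ) {m : ι} (hm : m ∈ s)
    (hem : 0 < e m) (he : ∀ i ∈ s, i ≠ m → 0 < e i ∧ e i < e m) {G : ι → ℝ → ℝ}
    (hG : ∀ i ∈ s, ContinuousOn (G i) (Icc 0 1)) :
    UC (fun k x => ∑ i ∈ s, (c i * (e i / e m) ^ k) * G i x) (fun x => c m * G m x) := by
  have hB : ∀ i ∈ s, ∃ B : ℝ, ∀ x ∈ Icc (0:ℝ) 1, |G i x| ≤ B := fun i hi =>
    isCompact_Icc.exists_bound_of_continuousOn (hG i hi)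
  choose! B hB using hB
  have lim : Tendsto (fun k : ℕ => ∑ i ∈ s.erase m, (|c i| * (e i / e m) ^ k) * B i) atTop
      (𝓝 (∑ i ∈ s.erase m, (|c i| * 0) * B i)) := by
    apply tendsto_finsetSum
    intro i hi
    obtain ⟨h1, h2⟩ := he i (Finset.mem_of_mem_erase hi) (Finset.ne_of_mem_erase hi)
    exact ((tendsto_pow_atTop_nhds_zero_of_lt_one (div_pos h1 hem).le
      ((div_lt_one hem).2 h2)).const_mul _).mul_const _
  simp only [mul_zero, zero_mul, Finset.sum_const_zero] at lim
  intro ε hε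
  filter_upwards [lim.eventually (gt_mem_nhds hε)] with k hk x hx
  refine lt_of_le_of_lt ?_ hk
  rw [← Finset.add_sum_erase s _ hm, div_self hem.ne', one_pow, mul_one, add_sub_cancel_left]
  refine (Finset.abs_sum_le_sum_abs _ _).trans (Finset.sum_le_sum fun i hi => ?_)
  obtain ⟨h1, h2⟩ := he i (Finset.mem_of_mem_erase hi) (Finset.ne_of_mem_erase hi)
  have h3 : 0 ≤ (e i / e m) ^ k := pow_nonneg (div_pos h1 hem).le _
  rw [abs_mul, abs_mul, abs_of_nonneg h3]
  exact mul_le_mul_of_nonneg_left (hB i (Finset.mem_of_mem_erase hi) x hx) (by positivity)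

/-- Zeros of a combination of eigenfunctions are dominated by the top eigenfunction. -/
theorem top_zeros {p r : ℝ → ℝ} (hc : Coef p r) {ι : Type*} [DecidableEq ι] (s : Finset ι)
    (e c : ι → ℝ) {m : ι} (hm : m ∈ s) (he : ∀ i ∈ s, i ≠ m → 0 < e i ∧ e i < e m)
    (hcm : c m ≠ 0) {u v w z : ι → ℝ → ℝ}
    (H : ∀ i ∈ s, Cl p r (fun x => e i * u i x) (u i) (v i) (w i) (z i)) (hnt : Nontriv (u m))
    {N : ℕ} (hN : ZGe (fun x => ∑ i ∈ s, c i * u i x) N) : ZGe (u m) N := by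
  have hem : 0 < e m := eig_pos hc (H m hm) hnt
  have K : ∀ k : ℕ, Cl p r _ _ _ _ _ := fun k => Cl.sum s (fun i => c i * (e i / e m) ^ k) H
  have hz : ∀ k : ℕ, ZGe (fun x => ∑ i ∈ s, (c i * (e i / e m) ^ k) * u i x) N := by
    intro k
    induction k with
    | zero => simpa using hN
    | succ k ih =>
      refine ((K k).zeros hc ih).map fun x _ h0 => ?_
      have : ∑ i ∈ s, (c i * (e i / e m) ^ k) * (e i * u i x) =
          e m * ∑ i ∈ s, (c i * (e i / e m) ^ (k + 1)) * u i x := by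
        rw [Finset.mul_sum]
        refine Finset.sum_congr rfl fun i _ => ?_
        rw [pow_succ]; field_simp
      rw [this] at h0
      exact (mul_eq_zero.1 h0).resolve_left hem.ne'
  have m0 : (0:ℝ) ∈ Icc (0:ℝ) 1 := left_mem_Icc.2 zero_le_one
  have m1 : (1:ℝ) ∈ Icc (0:ℝ) 1 := right_mem_Icc.2 zero_le_one
  have cw : ∀ i ∈ s, ContinuousOn (fun x => w i x / p x) (Icc 0 1) := fun i hi =>
    (H i hi).dw.cont.div hc.pc fun x hx => (hc.pp x hx).ne'
  have res : ZGe (fun x => c m * u m x) N := by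
    refine zeros_limit (fun k => (K k).dy) (fun k => (K k).dv.congr (g' := fun x =>
        ∑ i ∈ s, (c i * (e i / e m) ^ k) * (w i x / p x)) fun x _ => ?_)
      (fun k => (K k).y0) (fun k => (K k).v0) (fun k => (K k).y1) (fun k => (K k).v1)
      (UC_top s e c hm hem he fun i hi => (H i hi).dy.cont)
      (UC_top s e c hm hem he fun i hi => (H i hi).dv.cont)
      (UC_top s e c hm hem he (G := fun i x => w i x / p x) cw)
      (continuousOn_const.mul (H m hm).dy.cont) (continuousOn_const.mul (H m hm).dv.cont)
      (continuousOn_const.mul (cw m hm)) ?_ ?_ ?_ hz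
    · rw [Finset.sum_div]
      exact Finset.sum_congr rfl fun i _ => by ring
    · intro x hx h0
      exact mul_ne_zero hcm (simple_zero hc hem (H m hm) hnt hx
        ((mul_eq_zero.1 h0).resolve_left hcm))
    · exact mul_ne_zero hcm (div_ne_zero (w0_ne hc hem (H m hm) hnt) (hc.pp 0 m0).ne')
    · exact mul_ne_zero hcm (div_ne_zero (w1_ne hc hem (H m hm) hnt) (hc.pp 1 m1).ne')
  exact res.map fun x _ h0 => (mul_eq_zero.1 h0).resolve_left hcm

/-! ### Uniform convergence tools -/

theorem UC.lim {F : ℕ → ℝ → ℝ} {g : ℝ → ℝ} (h : UC F g) {x : ℝ} (hx : x ∈ Icc (0:ℝ) 1) :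
    Tendsto (fun k => F k x) atTop (𝓝 (g x)) := by
  rw [Metric.tendsto_nhds]
  intro ε hε
  filter_upwards [h ε hε] with k hk
  exact hk x hx

theorem UC.add {F F' : ℕ → ℝ → ℝ} {g g' : ℝ → ℝ} (h : UC F g) (h' : UC F' g') :
    UC (fun k x => F k x + F' k x) (fun x => g x + g' x) := by
  intro ε hε
  filter_upwards [h (ε / 2) (by linarith), h' (ε / 2) (by linarith)] with k h1 h2 x hx
  have e1 := abs_lt.1 (h1 x hx)
  have e2 := abs_lt.1 (h2 x hx)
  rw [abs_lt]
  constructor <;> linarith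

theorem UC.smul {F : ℕ → ℝ → ℝ} {g : ℝ → ℝ} (h : UC F g) (c : ℝ) :
    UC (fun k x => c * F k x) (fun x => c * g x) := by
  intro ε hε
  have hc : 0 < |c| + 1 := by positivity
  filter_upwards [h (ε / (|c| + 1)) (by positivity)] with k h1 x hx
  rw [← mul_sub, abs_mul]
  have h2 := h1 x hx
  rw [lt_div_iff₀ hc] at h2
  nlinarith [abs_nonneg (F k x - g x)]

theorem UC.mul {F F' : ℕ → ℝ → ℝ} {g g' : ℝ → ℝ} (h : UC F g) (h' : UC F' g')
    (hg : ContinuousOn g (Icc 0 1)) (hg' : ContinuousOn g' (Icc 0 1)) :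
    UC (fun k x => F k x * F' k x) (fun x => g x * g' x) := by
  obtain ⟨B, hB⟩ := isCompact_Icc.exists_bound_of_continuousOn hg
  obtain ⟨B', hB'⟩ := isCompact_Icc.exists_bound_of_continuousOn hg'
  simp only [Real.norm_eq_abs] at hB hB'
  intro ε hε
  set M := |B| + |B'| + 1 with hM
  have hMp : 0 < M := by positivity
  set η := min 1 (ε / (2 * M)) with hη
  have hηp : 0 < η := lt_min one_pos (by positivity)
  filter_upwards [h η hηp, h' η hηp] with k h1 h2 x hx
  have a1 := h1 x hx
  have a2 := h2 x hx
  have b1 := (hB x hx).trans (le_abs_self B)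
  have b2 := (hB' x hx).trans (le_abs_self B')
  have e : F k x * F' k x - g x * g' x =
      (F k x - g x) * (F' k x - g' x) + (F k x - g x) * g' x + g x * (F' k x - g' x) := by ring
  rw [e]
  have t1 : η ≤ 1 := min_le_left _ _
  have t2 : η * (2 * M) ≤ ε := by
    rw [← le_div_iff₀ (by positivity)]; exact min_le_right _ _
  have n1 := abs_nonneg (F k x - g x)
  have n2 := abs_nonneg (F' k x - g' x)
  calc _ ≤ |F k x - g x| * |F' k x - g' x| + |F k x - g x| * |g' x| + |g x| * |F' k x - g' x| := by
        rw [← abs_mul, ← abs_mul, ← abs_mul]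
        exact (abs_add_le _ _).trans (add_le_add_left (abs_add_le _ _) _)
    _ ≤ η * 1 + η * |B'| + |B| * η := by
        gcongr
        exact a2.le.trans t1
    _ = η * M := by rw [hM]; ring
    _ < ε := by nlinarith [mul_pos hηp hMp]

theorem UC.integral {ρ : ℝ → ℝ} (hρ : ContinuousOn ρ (Icc 0 1)) {F : ℕ → ℝ → ℝ} {g : ℝ → ℝ}
    (h : UC F g) (hF : ∀ k, ContinuousOn (F k) (Icc 0 1)) (hg : ContinuousOn g (Icc 0 1)) :
    Tendsto (fun k => ∫ x in (0:ℝ)..1, ρ x * F k x) atTop (𝓝 (∫ x in (0:ℝ)..1, ρ x * g x)) := by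
  obtain ⟨B, hB⟩ := isCompact_Icc.exists_bound_of_continuousOn hρ
  simp only [Real.norm_eq_abs] at hB
  rw [Metric.tendsto_nhds]
  intro ε hε
  have hM : 0 < |B| + 1 := by positivity
  filter_upwards [h (ε / (|B| + 1)) (by positivity)] with k hk
  have i1 : IntervalIntegrable (fun x => ρ x * F k x) volume 0 1 :=
    (hρ.mul (hF k)).intervalIntegrable_of_Icc zero_le_one
  have i2 : IntervalIntegrable (fun x => ρ x * g x) volume 0 1 :=
    (hρ.mul hg).intervalIntegrable_of_Icc zero_le_one
  rw [dist_eq_norm, ← intervalIntegral.integral_sub i1 i2]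
  have : ‖∫ x in (0:ℝ)..1, (ρ x * F k x - ρ x * g x)‖ ≤ (|B| * (ε / (|B| + 1))) * |1 - 0| := by
    apply intervalIntegral.norm_integral_le_of_norm_le_const
    intro x hx
    rw [uIoc_of_le zero_le_one] at hx
    have hx' := Ioc_subset_Icc_self hx
    rw [← mul_sub, Real.norm_eq_abs, abs_mul]
    exact mul_le_mul ((hB x hx').trans (le_abs_self B)) (hk x hx').le (abs_nonneg _) (abs_nonneg _)
  refine this.trans_lt ?_
  simp only [sub_zero, abs_one, mul_one]
  rw [mul_div_assoc', div_lt_iff₀ hM]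
  nlinarith [abs_nonneg B]

theorem UC.ip {ρ : ℝ → ℝ} (hρ : ContinuousOn ρ (Icc 0 1)) {F F' : ℕ → ℝ → ℝ} {g g' : ℝ → ℝ}
    (h : UC F g) (h' : UC F' g') (hF : ∀ k, ContinuousOn (F k) (Icc 0 1))
    (hF' : ∀ k, ContinuousOn (F' k) (Icc 0 1))
    (hg : ContinuousOn g (Icc 0 1)) (hg' : ContinuousOn g' (Icc 0 1)) :
    Tendsto (fun k => ip ρ (F k) (F' k)) atTop (𝓝 (ip ρ g g')) :=
  (h.mul h' hg hg').integral hρ (fun k => (hF k).mul (hF' k)) (hg.mul hg')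

theorem UC.const (g : ℝ → ℝ) : UC (fun _ => g) g := by
  intro ε hε
  exact Eventually.of_forall fun k x _ => by simpa using hε

theorem UC.step {p r : ℝ → ℝ} (hc : Coef p r) {F Y V W Z : ℕ → ℝ → ℝ} {f y v w z : ℝ → ℝ}
    (h : UC F f) (hF : ∀ k, ContinuousOn (F k) (Icc 0 1)) (hf : ContinuousOn f (Icc 0 1))
    (HF : ∀ k, Cl p r (F k) (Y k) (V k) (W k) (Z k)) (Hf : Cl p r f y v w z) : UC Y y := by
  obtain ⟨C, hC, hb⟩ := bounds hc
  have hd : UC (fun k x => F k x + (-1) * f x) (fun x => f x + (-1) * f x) :=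
    h.add (UC.const _)
  have cd : ∀ k, ContinuousOn (fun x => F k x + (-1) * f x) (Icc 0 1) := fun k =>
    (hF k).add (continuousOn_const.mul hf)
  have c0 : ContinuousOn (fun x => f x + (-1) * f x) (Icc 0 1) :=
    hf.add (continuousOn_const.mul hf)
  have lim := (hd.ip hc.rc hd cd cd c0 c0).const_mul C
  have e0 : _root_.ip r (fun x => f x + (-1) * f x) (fun x => f x + (-1) * f x) = 0 := by
    simp [_root_.ip]
  rw [e0, mul_zero] at lim
  intro ε hε
  filter_upwards [lim.eventually (gt_mem_nhds (by positivity : (0:ℝ) < ε ^ 2))] with k hk x hx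
  have := (hb _ _ _ _ _ (cd k) ((HF k).add (Hf.smul (-1))) x hx).2
  have h3 : (Y k x - y x) ^ 2 < ε ^ 2 := by
    refine lt_of_le_of_lt (le_of_eq ?_) (this.trans_lt hk)
    ring
  exact abs_lt_of_sq_lt_sq h3 hε.le

/-- Arzela-Ascoli for equi-Lipschitz sequences. -/
theorem arzela {H : ℕ → ℝ → ℝ} {L : ℝ} (hL : 0 ≤ L)
    (hlip : ∀ k, ∀ x ∈ Icc (0:ℝ) 1, ∀ t ∈ Icc (0:ℝ) 1, |H k t - H k x| ≤ L * |t - x|)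
    (hbd : ∀ k, ∀ x ∈ Icc (0:ℝ) 1, |H k x| ≤ L) :
    ∃ (g : ℝ → ℝ) (φ : ℕ → ℕ), StrictMono φ ∧ ContinuousOn g (Icc 0 1) ∧
      UC (fun j => H (φ j)) g := by
  have lw : ∀ k, LipschitzWith ⟨L, hL⟩ (fun x : Icc (0:ℝ) 1 => H k x) := fun k =>
    LipschitzWith.of_dist_le_mul fun x y => by
      rw [Real.dist_eq, Subtype.dist_eq, Real.dist_eq]
      exact hlip k y y.2 x x.2
  let G : ℕ → BoundedContinuousFunction (Icc (0:ℝ) 1) ℝ := fun k =>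
    BoundedContinuousFunction.mkOfCompact ⟨fun x => H k x, (lw k).continuous⟩
  have hcomp : IsCompact (closure (range G)) := by
    apply BoundedContinuousFunction.arzela_ascoli (Icc (-L) L) isCompact_Icc
    · rintro f x ⟨k, rfl⟩
      exact abs_le.1 (hbd k x x.2)
    · apply UniformEquicontinuous.equicontinuous
      apply LipschitzWith.uniformEquicontinuous _ ⟨L, hL⟩
      rintro ⟨f, k, rfl⟩
      exact lw k
  obtain ⟨g, -, φ, hφ, hlim⟩ := hcomp.tendsto_subseq (x := G) fun k => subset_closure ⟨k, rfl⟩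
  refine ⟨IccExtend (zero_le_one (α := ℝ)) g, φ, hφ, ?_, ?_⟩
  · exact (Continuous.Icc_extend' g.continuous).continuousOn
  · intro ε hε
    filter_upwards [Metric.tendsto_nhds.1 hlim ε hε] with k hk x hx
    rw [IccExtend_of_mem _ _ hx]
    have := (BoundedContinuousFunction.dist_coe_le_dist (f := G (φ k)) (g := g) ⟨x, hx⟩).trans_lt hk
    exact this

/-! ### Power iteration -/

theorem HD_zero {f g : ℝ → ℝ} (h : HD f g) (h0 : ∀ x ∈ Icc (0:ℝ) 1, f x = 0) :
    ∀ x ∈ Icc (0:ℝ) 1, g x = 0 := by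
  intro x hx
  have d2 : HasDerivWithinAt f 0 (Icc 0 1) x :=
    (hasDerivWithinAt_const x (Icc (0:ℝ) 1) (0:ℝ)).congr h0 (h0 x hx)
  exact (uniqueDiffOn_Icc one_pos x hx).eq_deriv _ (h x hx) d2

theorem Cl.rhs_zero {p r f y v w z : ℝ → ℝ} (hc : Coef p r) (H : Cl p r f y v w z)
    (h0 : ∀ x ∈ Icc (0:ℝ) 1, y x = 0) : ∀ x ∈ Icc (0:ℝ) 1, f x = 0 := by
  have h1 := HD_zero H.dy h0
  have h2 := HD_zero H.dv h1
  have h3 : ∀ x ∈ Icc (0:ℝ) 1, w x = 0 := fun x hx =>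
    (div_eq_zero_iff.1 (h2 x hx)).resolve_right (hc.pp x hx).ne'
  have h5 := HD_zero H.dz (HD_zero H.dw h3)
  exact fun x hx => (mul_eq_zero.1 (h5 x hx)).resolve_left (hc.rp x hx).ne'

theorem ip_pos {ρ f : ℝ → ℝ} (hρc : ContinuousOn ρ (Icc 0 1))
    (hρ : ∀ x ∈ Icc (0:ℝ) 1, 0 < ρ x) (hf : ContinuousOn f (Icc 0 1)) (h : Nontriv f) :
    0 < ip ρ f f := by
  refine lt_of_le_of_ne (ip_self_nonneg hρ f) fun h0 => ?_
  obtain ⟨x, hx, hn⟩ := h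
  exact hn (ip_self_zero hρc hρ hf h0.symm x hx)

theorem exists_iter {p r f0 : ℝ → ℝ} (hc : Coef p r) (hf0 : ContinuousOn f0 (Icc 0 1)) :
    ∃ y v w z : ℕ → ℝ → ℝ, y 0 = f0 ∧ (∀ k, ContinuousOn (y k) (Icc 0 1)) ∧
      ∀ k, Cl p r (y k) (y (k + 1)) (v k) (w k) (z k) := by
  have ex : ∀ f : ℝ → ℝ, ContinuousOn f (Icc 0 1) → ∃ y v w z, Cl p r f y v w z :=
    fun f hf => exists_Cl hc hf
  choose! Y V W Z hY using ex
  have hcont : ∀ k : ℕ, ContinuousOn (Y^[k] f0) (Icc 0 1) := by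
    intro k
    induction k with
    | zero => exact hf0
    | succ k ih =>
      rw [Function.iterate_succ_apply']
      exact (hY _ ih).dy.cont
  refine ⟨fun k => Y^[k] f0, fun k => V (Y^[k] f0), fun k => W (Y^[k] f0), fun k => Z (Y^[k] f0),
    rfl, hcont, fun k => ?_⟩
  show Cl p r (Y^[k] f0) (Y^[k + 1] f0) _ _ _
  rw [Function.iterate_succ_apply']
  exact hY _ (hcont k)

theorem power_iter {p r f0 : ℝ → ℝ} (hc : Coef p r) (hf0 : ContinuousOn f0 (Icc 0 1))
    (hnt : Nontriv f0) : ∃ (l : ℝ) (g v w z : ℝ → ℝ), Cl p r (fun x => l * g x) g v w z ∧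
      Nontriv g ∧ (∀ N, ZGe g N → ZGe f0 N) ∧
      ∀ (μ : ℝ) (u v w z : ℝ → ℝ), Cl p r (fun x => μ * u x) u v w z → Nontriv u →
        ip r f0 u = 0 → ip r g u = 0 := by
  obtain ⟨y, yv, yw, yz, hy0, cy, Hy⟩ := exists_iter hc hf0
  have ny : ∀ k, Nontriv (y k) := by
    intro k
    induction k with
    | zero => rw [hy0]; exact hnt
    | succ k ih =>
      by_contra hcon
      obtain ⟨x, hx, hn⟩ := ih
      refine hn ((Hy k).rhs_zero hc (fun t ht => ?_) x hx)
      by_contra h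
      exact hcon ⟨t, ht, h⟩
  obtain ⟨b, hb⟩ : ∃ b : ℕ → ℝ, ∀ k, b k = ip r (y k) (y k) := ⟨_, fun _ => rfl⟩
  have bpos : ∀ k, 0 < b k := fun k => by rw [hb]; exact ip_pos hc.rc hc.rp (cy k) (ny k)
  have bs : ∀ k, ip r (y (k + 2)) (y k) = b (k + 1) := fun k => by
    rw [hb, ip_comm]
    exact symm_ip hc (cy k) (cy (k + 1)) (Hy k) (Hy (k + 1))
  have cs : ∀ k, b (k + 1) ^ 2 ≤ b (k + 2) * b k := fun k => by
    rw [← bs, hb, hb]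
    exact ip_cs hc.rc hc.rp (cy _) (cy _)
  obtain ⟨q, hq⟩ : ∃ q : ℕ → ℝ, ∀ k, q k = b (k + 1) / b k := ⟨_, fun _ => rfl⟩
  have qpos : ∀ k, 0 < q k := fun k => by rw [hq]; exact div_pos (bpos _) (bpos _)
  have qmono : Monotone q := by
    refine monotone_nat_of_le_succ fun k => ?_
    rw [hq, hq, div_le_div_iff₀ (bpos _) (bpos _)]
    nlinarith [cs k]
  obtain ⟨C, hC, hbd⟩ := bounds hc
  have qbdd : ∀ k, q k ≤ C * ip r 1 1 := fun k => by
    rw [hq, div_le_iff₀ (bpos k)]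
    have := ip_le hc.rc hc.rp (cy (k + 1)) (B := C * b k)
      (fun x hx => by rw [hb]; exact (hbd _ _ _ _ _ (cy k) (Hy k) x hx).2)
    rw [← hb] at this
    linarith
  obtain ⟨Q, hQ⟩ : ∃ Q, Tendsto q atTop (𝓝 Q) :=
    ⟨_, tendsto_atTop_ciSup qmono ⟨_, by rintro _ ⟨k, rfl⟩; exact qbdd k⟩⟩
  have Qpos : 0 < Q := (qpos 0).trans_le (qmono.ge_of_tendsto hQ 0)
  obtain ⟨a, ha⟩ : ∃ a : ℕ → ℝ, ∀ k, a k = (√(b k))⁻¹ := ⟨_, fun _ => rfl⟩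
  have a2 : ∀ k, a k ^ 2 = (b k)⁻¹ := fun k => by
    rw [ha, inv_pow, Real.sq_sqrt (bpos k).le]
  have key : ∀ k s, s ≤ C * b k → a (k + 1) ^ 2 * s ≤ C / q 0 := by
    intro k s hs
    have h1 : a (k + 1) ^ 2 * s ≤ C / q k := by
      rw [a2, hq, div_div_eq_mul_div, inv_mul_eq_div]
      exact div_le_div_of_nonneg_right hs (bpos _).le
    exact h1.trans (div_le_div_of_nonneg_left hC (qpos 0) (qmono (Nat.zero_le k)))
  have vb : ∀ k, ∀ x ∈ Icc (0:ℝ) 1, |a (k + 1) * yv k x| ≤ √(C / q 0) := by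
    intro k x hx
    apply Real.abs_le_sqrt
    rw [mul_pow]
    exact key k _ (by rw [hb]; exact (hbd _ _ _ _ _ (cy k) (Hy k) x hx).1)
  have yb : ∀ k, ∀ x ∈ Icc (0:ℝ) 1, |a (k + 1) * y (k + 1) x| ≤ √(C / q 0) := by
    intro k x hx
    apply Real.abs_le_sqrt
    rw [mul_pow]
    exact key k _ (by rw [hb]; exact (hbd _ _ _ _ _ (cy k) (Hy k) x hx).2)
  obtain ⟨g0, φ, hφ, cg0, ucF⟩ := arzela (H := fun k x => a (k + 1) * y (k + 1) x)
    (Real.sqrt_nonneg (C / q 0))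
    (fun k x hx t ht => ((Hy k).dy.smul (a (k + 1))).lip (vb k) hx ht) yb
  obtain ⟨κ, hκ⟩ : ∃ κ : ℕ → ℕ, ∀ j, κ j = φ j + 1 := ⟨_, fun _ => rfl⟩
  have κlim : Tendsto κ atTop atTop := by
    have : κ = fun j => φ j + 1 := funext hκ
    rw [this]
    exact (tendsto_add_atTop_nat 1).comp hφ.tendsto_atTop
  simp only [← hκ] at ucF
  obtain ⟨h, hv, hw, hz, Hh⟩ := exists_Cl hc cg0
  obtain ⟨h2, h2v, h2w, h2z, Hh2⟩ := exists_Cl hc Hh.dy.cont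
  have cS : ∀ j i, ContinuousOn (fun x => a (κ j) * y (κ j + i) x) (Icc 0 1) := fun j i =>
    continuousOn_const.mul (cy _)
  have ucY : UC (fun j x => a (κ j) * y (κ j + 1) x) h :=
    ucF.step hc (fun j => cS j 0) cg0 (fun j => (Hy (κ j)).smul (a (κ j))) Hh
  have ucZ : UC (fun j x => a (κ j) * y (κ j + 2) x) h2 :=
    ucY.step hc (fun j => cS j 1) Hh.dy.cont (fun j => (Hy (κ j + 1)).smul (a (κ j))) Hh2
  have ipS : ∀ j (f f' : ℝ → ℝ), ip r (fun x => a (κ j) * f x) (fun x => a (κ j) * f' x) =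
      ip r f f' / b (κ j) := fun j f f' => by
    rw [ip_smul, ip_smul_right, ← mul_assoc, ← pow_two, a2, inv_mul_eq_div]
  have e1 : ip r g0 g0 = 1 := by
    have l1 := UC.ip hc.rc ucF ucF (fun j => cS j 0) (fun j => cS j 0) cg0 cg0
    refine tendsto_nhds_unique l1 (tendsto_const_nhds.congr fun j => ?_)
    rw [ipS, ← hb, div_self (bpos _).ne']
  have e2 : ip r h2 g0 = Q := by
    have l1 := UC.ip hc.rc ucZ ucF (fun j => cS j 2) (fun j => cS j 0) Hh2.dy.cont cg0
    refine tendsto_nhds_unique l1 ((hQ.comp κlim).congr fun j => ?_)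
    rw [ipS, bs, Function.comp, hq]
  have e3 : ip r h2 h2 = Q * Q := by
    have l1 := UC.ip hc.rc ucZ ucZ (fun j => cS j 2) (fun j => cS j 2) Hh2.dy.cont Hh2.dy.cont
    refine tendsto_nhds_unique l1
      (((hQ.comp ((tendsto_add_atTop_nat 1).comp κlim)).mul (hQ.comp κlim)).congr fun j => ?_)
    rw [ipS, ← hb]
    simp only [Function.comp, hq]
    have := (bpos (κ j)).ne'
    have := (bpos (κ j + 1)).ne'
    field_simp
  have c2 := Hh2.dy.cont
  have ch := Hh.dy.cont
  have eq2 : ∀ x ∈ Icc (0:ℝ) 1, h2 x = Q * g0 x := by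
    have cm : ContinuousOn (fun x => (-Q) * g0 x) (Icc 0 1) := continuousOn_const.mul cg0
    have cs2 : ContinuousOn (fun x => h2 x + (-Q) * g0 x) (Icc 0 1) := c2.add cm
    have h0 : ip r (fun x => h2 x + (-Q) * g0 x) (fun x => h2 x + (-Q) * g0 x) = 0 := by
      rw [ip_add hc.rc c2 cm cs2, ip_add_right hc.rc c2 cm c2,
        ip_add_right hc.rc c2 cm cm, ip_smul, ip_smul, ip_smul_right, ip_smul_right,
        ip_comm r g0 h2, e1, e2, e3]
      ring
    intro x hx
    have := ip_self_zero hc.rc hc.rp cs2 h0 x hx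
    linarith
  obtain ⟨t, ht, htQ⟩ : ∃ t, 0 < t ∧ t * t = Q :=
    ⟨√Q, Real.sqrt_pos.2 Qpos, Real.mul_self_sqrt Qpos.le⟩
  have cd : ContinuousOn (fun x => h x + (-t) * g0 x) (Icc 0 1) :=
    ch.add (continuousOn_const.mul cg0)
  have eq1 : ∀ x ∈ Icc (0:ℝ) 1, h x = t * g0 x := by
    have Hd := Hh2.add (Hh.smul (-t))
    have en := energy hc cd Hd Hd
    have en0 := ip_self_nonneg hc.qp (fun x => h2w x + (-t) * hw x)
    rw [← en] at en0
    have ec : ip r (fun x => h x + (-t) * g0 x) (fun x => h2 x + (-t) * h x) =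
        ip r (fun x => h x + (-t) * g0 x) (fun x => (-t) * (h x + (-t) * g0 x)) :=
      ip_congr (fun _ _ => rfl) fun x hx => by
        rw [eq2 x hx, ← htQ]; ring
    rw [ec, ip_smul_right] at en0
    have nn := ip_self_nonneg hc.rp (fun x => h x + (-t) * g0 x)
    have z0 : ip r (fun x => h x + (-t) * g0 x) (fun x => h x + (-t) * g0 x) = 0 := by
      nlinarith
    intro x hx
    have := ip_self_zero hc.rc hc.rp cd z0 x hx
    linarith
  have HE : Cl p r (fun x => t⁻¹ * h x) h hv hw hz := Hh.congr fun x hx => by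
    rw [eq1 x hx, inv_mul_cancel_left₀ ht.ne']
  have nh : Nontriv h := by
    by_contra hcon
    have : ip r g0 g0 = 0 := by
      have : ∀ x ∈ Icc (0:ℝ) 1, g0 x = (fun _ => (0:ℝ)) x := fun x hx => by
        have h0 : h x = 0 := by
          by_contra hne
          exact hcon ⟨x, hx, hne⟩
        rw [eq1 x hx] at h0
        exact (mul_eq_zero.1 h0).resolve_left ht.ne'
      rw [ip_congr this this]
      simp [ip]
    linarith
  refine ⟨t⁻¹, h, hv, hw, hz, HE, nh, fun N hN => ?_, fun μ u uv uw uz HU nu hou => ?_⟩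
  · have ev := persist HE.dy hN (fun x hx h0 => simple_zero hc (inv_pos.2 ht) HE nh hx h0)
      (F := fun j x => t * (a (κ j) * y (κ j) x))
      (fun j => continuousOn_const.mul (cS j 0)) (fun x hx => by
        rw [eq1 x hx]
        exact (ucF.lim hx).const_mul t)
    obtain ⟨j, hj⟩ := ev.exists
    have an : a (κ j) ≠ 0 := by
      rw [ha]; exact (inv_pos.2 (Real.sqrt_pos.2 (bpos _))).ne'
    have hj' : ZGe (y (κ j)) N := hj.map fun x _ h0 =>
      (mul_eq_zero.1 ((mul_eq_zero.1 h0).resolve_left ht.ne')).resolve_left an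
    have down : ∀ k, ZGe (y k) N → ZGe (y 0) N := by
      intro k
      induction k with
      | zero => exact id
      | succ k ih => exact fun hk => ih ((Hy k).zeros hc hk)
    rw [← hy0]
    exact down _ hj'
  · have μpos := eig_pos hc HU nu
    have cu := HU.dy.cont
    have cmu : ContinuousOn (fun x => μ * u x) (Icc 0 1) := continuousOn_const.mul cu
    have orth : ∀ k, ip r (y k) u = 0 := by
      intro k
      induction k with
      | zero => rw [hy0]; exact hou
      | succ k ih =>
        have := symm_ip hc (cy k) cmu (Hy k) HU
        rw [ih, ip_smul] at this
        rw [ip_comm]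
        exact (mul_eq_zero.1 this.symm).resolve_left μpos.ne'
    have l1 := UC.ip hc.rc ucY (UC.const u) (fun j => cS j 1) (fun _ => cu) ch cu
    refine tendsto_nhds_unique l1 (tendsto_const_nhds.congr fun j => ?_)
    rw [ip_smul, orth, mul_zero]

/-! ### Counting zeros -/

theorem exists_ker {ι κ : Type*} [Fintype ι] [Fintype κ] (A : ι → κ → ℝ)
    (h : Fintype.card κ < Fintype.card ι) :
    ∃ c : ι → ℝ, c ≠ 0 ∧ ∀ k, ∑ i, c i * A i k = 0 := by
  classical
  let M : Matrix κ ι ℝ := fun k i => A i k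
  have hk : LinearMap.ker M.mulVecLin ≠ ⊥ := by
    apply LinearMap.ker_ne_bot_of_finrank_lt
    simpa using h
  obtain ⟨c, hc, hne⟩ := (Submodule.ne_bot_iff _).1 hk
  refine ⟨c, hne, fun k => ?_⟩
  have := congrFun (LinearMap.mem_ker.1 hc) k
  simp only [Matrix.mulVecLin_apply, Matrix.mulVec, dotProduct, Pi.zero_apply, M] at this
  rw [← this]
  exact Finset.sum_congr rfl fun i _ => mul_comm _ _

theorem ip_sum {ρ g : ℝ → ℝ} (hρ : ContinuousOn ρ (Icc 0 1)) {ι : Type*} (s : Finset ι) (c : ι → ℝ)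
    {f : ι → ℝ → ℝ} (hf : ∀ i ∈ s, ContinuousOn (f i) (Icc 0 1)) (hg : ContinuousOn g (Icc 0 1)) :
    ip ρ (fun x => ∑ i ∈ s, c i * f i x) g = ∑ i ∈ s, c i * ip ρ (f i) g := by
  classical
  induction s using Finset.induction_on with
  | empty => simp [ip]
  | insert a s ha ih =>
    have h1 : ContinuousOn (fun x => c a * f a x) (Icc 0 1) :=
      continuousOn_const.mul (hf a (Finset.mem_insert_self a s))
    have h2 : ContinuousOn (fun x => ∑ i ∈ s, c i * f i x) (Icc 0 1) :=
      continuousOn_finsetSum s fun i hi =>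
        continuousOn_const.mul (hf i (Finset.mem_insert_of_mem hi))
    rw [Finset.sum_insert ha, ← ih fun i hi => hf i (Finset.mem_insert_of_mem hi), ← ip_smul,
      ← ip_add hρ h1 h2 hg]
    congr 1
    ext x
    rw [Finset.sum_insert ha]

theorem poly_zeros {m : ℕ} {c : Fin (m + 1) → ℝ} (hc : c ≠ 0) {N : ℕ}
    (h : ZGe (fun x => ∑ i, c i * x ^ (i:ℕ)) N) : N ≤ m := by
  obtain ⟨s, -, h0, hN⟩ := h
  by_contra hlt
  apply hc
  let P := (Polynomial.degreeLTEquiv ℝ (m + 1)).symm c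
  have hP : P.1 = 0 := by
    apply Polynomial.eq_zero_of_degree_lt_of_eval_finset_eq_zero s
    · refine (Polynomial.mem_degreeLT.1 P.2).trans_le ?_
      exact_mod_cast (by omega : m + 1 ≤ s.card)
    · intro x hx
      rw [Polynomial.eval_eq_sum_degreeLTEquiv P.2]
      simpa [P] using h0 x hx
  have hP' : P = 0 := Subtype.ext hP
  exact (LinearEquiv.map_eq_zero_iff _).1 hP'

/-- Upper bound for the number of zeros. -/
theorem upper {p r u v w z : ℝ → ℝ} {ν : ℝ} (hc : Coef p r)
    (H : Cl p r (fun x => ν * u x) u v w z) (hnt : Nontriv u) (E : Finset ℝ)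
    (hE : ∀ μ, EigS1 p r μ → μ < ν → μ ∈ E) (hE' : ∀ μ ∈ E, EigS1 p r μ) {N : ℕ}
    (hN : ZGe u N) : N ≤ E.card := by
  have hE2 : ∀ μ ∈ E, ∃ y v w z, Cl p r (fun x => μ * y x) y v w z ∧ Nontriv y := fun μ hμ => by
    obtain ⟨y, h1, h2, h3⟩ := hE' μ hμ
    exact ⟨y, _, _, _, Cl_of_SolS hc h1 h3, h2⟩
  choose! U UV UW UZ HU nU using hE2
  have cx : ∀ i : ℕ, ContinuousOn (fun x : ℝ => x ^ i) (Icc 0 1) := fun i =>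
    (continuous_pow i).continuousOn
  obtain ⟨c, hc0, hcE⟩ := exists_ker (ι := Fin (E.card + 1)) (κ := E)
    (fun i μ => ip r (fun x => x ^ (i:ℕ)) (U μ)) (by simp)
  have cf : ContinuousOn (fun x => ∑ i : Fin (E.card + 1), c i * x ^ (i:ℕ)) (Icc 0 1) :=
    continuousOn_finsetSum _ fun i _ => continuousOn_const.mul (cx i)
  have nf : Nontriv (fun x => ∑ i : Fin (E.card + 1), c i * x ^ (i:ℕ)) := by
    by_contra hcon
    obtain ⟨t, ht, htc⟩ := (Ioo_infinite (zero_lt_one (α := ℝ))).exists_subset_card_eq (E.card + 1)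
    have : E.card + 1 ≤ E.card := poly_zeros hc0 ⟨t, fun x hx => ht hx, fun x hx => by
      by_contra hne
      exact hcon ⟨x, Ioo_subset_Icc_self (ht hx), hne⟩, htc.ge⟩
    omega
  obtain ⟨l, g, gv, gw, gz, HG, ng, hz, ho⟩ := power_iter hc cf nf
  refine poly_zeros hc0 (hz N ?_)
  have lpos := eig_pos hc HG ng
  have νpos := eig_pos hc H hnt
  rcases lt_trichotomy l ν with hl | hl | hl
  · exfalso
    have hlE := hE l (EigS1_of_Cl hc HG ng) hl
    have o1 : ip r g (U l) = 0 := by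
      refine ho l (U l) _ _ _ (HU l hlE) (nU l hlE) ?_
      rw [ip_sum hc.rc Finset.univ c (f := fun i x => x ^ (i:ℕ)) (fun i _ => cx i)
        (HU l hlE).dy.cont]
      exact hcE ⟨l, hlE⟩
    obtain ⟨k, hk⟩ := simple_eig hc lpos (HU l hlE) (nU l hlE) HG
    have o2 : ip r g g = 0 := by
      rw [ip_congr (f' := g) (fun _ _ => rfl) hk, ip_smul_right, o1, mul_zero]
    exact (ip_pos hc.rc hc.rp HG.dy.cont ng).ne' o2
  · subst hl
    obtain ⟨k, hk⟩ := simple_eig hc lpos H hnt HG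
    exact hN.map fun x hx h0 => by rw [hk x (Ioo_subset_Icc_self hx), h0, mul_zero]
  · have ev := persist H.dy hN (fun x hx h0 => simple_zero hc νpos H hnt hx h0)
      (F := fun k x => u x + (1 / ((k:ℝ) + 1)) * g x)
      (fun k => H.dy.cont.add (continuousOn_const.mul HG.dy.cont)) (fun x hx => by
        simpa using tendsto_const_nhds.add
          ((tendsto_one_div_add_atTop_nhds_zero_nat (𝕜 := ℝ)).mul_const (g x)))
    obtain ⟨k, hk⟩ := ev.exists
    have kp : (1 / ((k:ℝ) + 1)) ≠ 0 := by positivity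
    refine top_zeros hc (Finset.univ : Finset Bool) (fun b => cond b l ν)
      (fun b => cond b (1 / ((k:ℝ) + 1)) 1) (m := true) (Finset.mem_univ _) ?_ kp
      (u := fun b => cond b g u) (v := fun b => cond b gv v) (w := fun b => cond b gw w)
      (z := fun b => cond b gz z) ?_ ng ?_
    · rintro (_ | _) _ h
      · exact ⟨νpos, hl⟩
      · exact absurd rfl h
    · rintro (_ | _) _
      · exact H
      · exact HG
    · refine hk.map fun x _ h0 => ?_
      simp only [Fintype.sum_bool, cond_true, cond_false, one_mul]
      linarith

/-- Lower bound for the number of zeros. -/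
theorem lower {p r y v w z : ℝ → ℝ} {lam : ℝ} (hc : Coef p r)
    (H : Cl p r (fun x => lam * y x) y v w z) (hnt : Nontriv y) (E : Finset ℝ)
    (hE : ∀ μ, μ ∈ E ↔ EigS1 p r μ ∧ μ < lam) : ZGe y E.card := by
  classical
  have hE2 : ∀ μ ∈ insert lam E, ∃ y v w z, Cl p r (fun x => μ * y x) y v w z ∧ Nontriv y := by
    intro μ hμ
    rcases Finset.mem_insert.1 hμ with rfl | hμ
    · exact ⟨y, _, _, _, H, hnt⟩
    · obtain ⟨y, h1, h2, h3⟩ := ((hE μ).1 hμ).1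
      exact ⟨y, _, _, _, Cl_of_SolS hc h1 h3, h2⟩
  choose! U UV UW UZ HU nU using hE2
  have hlE : lam ∉ E := fun h => lt_irrefl _ ((hE lam).1 h).2
  obtain ⟨t, ht, htc⟩ := (Ioo_infinite (zero_lt_one (α := ℝ))).exists_subset_card_eq E.card
  obtain ⟨c, hc0, hct⟩ := exists_ker (ι := (insert lam E : Finset ℝ)) (κ := t)
    (fun μ x => U μ x) (by simp [htc, Finset.card_insert_of_notMem hlE])
  let d : ℝ → ℝ := fun μ => if h : μ ∈ insert lam E then c ⟨μ, h⟩ else 0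
  have hd : ∀ μ : (insert lam E : Finset ℝ), d μ = c μ := fun μ => by simp only [d]; rw [dif_pos μ.2]
  let S := (insert lam E).filter fun μ => d μ ≠ 0
  have hS : S.Nonempty := by
    obtain ⟨i, hi⟩ := Function.ne_iff.1 hc0
    exact ⟨i, Finset.mem_filter.2 ⟨i.2, by rw [hd]; exact hi⟩⟩
  obtain ⟨m, hmS, hmax⟩ := S.exists_max_image id hS
  have hm := Finset.mem_filter.1 hmS
  have HS : ∀ i ∈ S, Cl p r (fun x => i * U i x) (U i) (UV i) (UW i) (UZ i) := fun i hi =>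
    HU i (Finset.mem_filter.1 hi).1
  have hz : ZGe (U m) E.card := by
    refine top_zeros hc S (fun μ => μ) d hmS (fun i hi hne => ⟨?_, ?_⟩) hm.2 HS (nU m hm.1) ?_
    · exact eig_pos hc (HS i hi) (nU i (Finset.mem_filter.1 hi).1)
    · exact lt_of_le_of_ne (hmax i hi) hne
    · refine ⟨t, fun x hx => ht hx, fun x hx => ?_, htc.ge⟩
      rw [← hct ⟨x, hx⟩]
      show ∑ i ∈ (insert lam E).filter (fun μ => d μ ≠ 0), d i * U i x = _
      rw [Finset.sum_filter, ← Finset.sum_coe_sort (insert lam E)]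
      refine Finset.sum_congr rfl fun i _ => ?_
      rw [hd]
      split_ifs with h
      · rfl
      · rw [not_not.1 h, zero_mul]
  have hml : m = lam := by
    rcases Finset.mem_insert.1 hm.1 with h | h
    · exact h
    · exfalso
      have hmE := (hE m).1 h
      have := upper hc (HU m hm.1) (nU m hm.1) (E.filter (· < m))
        (fun μ h1 h2 => Finset.mem_filter.2 ⟨(hE μ).2 ⟨h1, h2.trans hmE.2⟩, h2⟩)
        (fun μ h1 => ((hE μ).1 (Finset.mem_filter.1 h1).1).1) hz
      have lt : (E.filter (· < m)).card < E.card :=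
        Finset.card_lt_card (Finset.filter_ssubset.2 ⟨m, h, lt_irrefl m⟩)
      omega
  subst hml
  obtain ⟨k, hk⟩ := simple_eig hc (eig_pos hc H hnt) (HU m hm.1) (nU m hm.1) H
  exact hz.map fun x hx h0 => by rw [hk x (Ioo_subset_Icc_self hx), h0, mul_zero]

end Helpers

theorem stmt_8 (p r : ℝ → ℝ) (n : ℕ) (lam : ℝ) (y : ℝ → ℝ)
    (hpc : ContinuousOn p (Icc 0 1)) (hrc : ContinuousOn r (Icc 0 1))
    (hp : ∀ x ∈ Icc (0:ℝ) 1, 0 < p x) (hr : ∀ x ∈ Icc (0:ℝ) 1, 0 < r x)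
    (hn : 1 ≤ n)
    (heig : EigS1 p r lam)
    (hfin : {μ : ℝ | EigS1 p r μ ∧ μ < lam}.Finite)
    (hcard : {μ : ℝ | EigS1 p r μ ∧ μ < lam}.ncard = n - 1)
    (hy : SolS p r lam y) (hnt : Nontriv y) (hbc : BC1 y) :
    {x ∈ Ioo (0:ℝ) 1 | y x = 0}.Finite ∧
      {x ∈ Ioo (0:ℝ) 1 | y x = 0}.ncard = n - 1 ∧
      ∀ a ∈ Ioo (0:ℝ) 1, y a = 0 → Dv y a ≠ 0 := by
  have hc : Coef p r := ⟨hpc, hrc, hp, hr⟩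
  have H := Cl_of_SolS hc hy hbc
  have hE : ∀ μ, μ ∈ hfin.toFinset ↔ EigS1 p r μ ∧ μ < lam := fun μ => hfin.mem_toFinset
  have hn1 : hfin.toFinset.card = n - 1 := by
    rw [← hcard, Set.ncard_eq_toFinset_card _ hfin]
  have up : ∀ N, ZGe y N → N ≤ n - 1 := fun N hN => by
    rw [← hn1]
    exact upper hc H hnt hfin.toFinset (fun μ h1 h2 => (hE μ).2 ⟨h1, h2⟩)
      (fun μ h => ((hE μ).1 h).1) hN
  have lo : ZGe y (n - 1) := by
    rw [← hn1]
    exact lower hc H hnt hfin.toFinset hE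
  have fin : {x ∈ Ioo (0:ℝ) 1 | y x = 0}.Finite := by
    by_contra hinf
    obtain ⟨t, ht, htc⟩ := Set.Infinite.exists_subset_card_eq hinf (n - 1 + 1)
    have := up (n - 1 + 1) ⟨t, fun x hx => (ht hx).1, fun x hx => (ht hx).2, htc.ge⟩
    omega
  refine ⟨fin, ?_, fun a ha h0 => simple_zero hc (eig_pos hc H hnt) H hnt ha h0⟩
  rw [Set.ncard_eq_toFinset_card _ fin]
  apply le_antisymm
  · exact up _ ⟨fin.toFinset, fun x hx => (fin.mem_toFinset.1 hx).1,
      fun x hx => (fin.mem_toFinset.1 hx).2, le_rfl⟩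
  · obtain ⟨s, h1, h2, h3⟩ := lo
    exact h3.trans (Finset.card_le_card fun x hx => fin.mem_toFinset.2 ⟨h1 x hx, h2 x hx⟩)
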